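/- (Control of the iterated parametrix kernel.) Assume σ satisfies hypothesis (H^σ_α) with α ∈ (0,1), b satisfies hypothesis (H^b_0), and b, σ are smooth in the space variable with bounded spatial derivatives of every order. Set a := σσ*/2 and define the parametrix kernel H(s,x,t,y) := tr[(a(s,x) − a(s,θ_{s,t}(y)))·∇²_x p̃₁(s,x,t,y)] + ⟨b(s,x) − b(s,θ_{s,t}(y)), ∇_x p̃₁(s,x,t,y)⟩, and the space-time convolution (f ⊗ h)(s,x,t,y) := ∫_s^t ∫_{ℝ^d} f(s,x,r,z)·h(r,z,t,y) dz dr, with H^{⊗1} := H and H^{⊗(N+1)} := H ⊗ H^{⊗N}. Then for any T > 0 and any integer N ≥ 1 there exist constants C_N, λ_N > 0 depending only on Θ = (T,α,0,κ₀,κ₁,d) such that |H^{⊗N}(s,x,t,y)| ≤ C_N·(t−s)^{−1+Nα/2}·𝐠_{λ_N}(s,x,t,y) for all (s,t) ∈ 𝔻^T_0 and x,y ∈ ℝ^d. -/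

import Mathlib

noncomputable section

open MeasureTheory Matrix Set

/-- The state space `ℝ^d`. -/
abbrev Vec (d : ℕ) := EuclideanSpace ℝ (Fin d)

/-- Hypothesis (H^b_β): `b` is measurable, bounded at the origin uniformly in time
and Hölder/Lipschitz in space uniformly in time. -/
def HolderDrift (d : ℕ) (b : ℝ → Vec d → Vec d) (κ₁ β : ℝ) : Prop :=
  Measurable (Function.uncurry b) ∧
  (∀ t : ℝ, 0 ≤ t → ‖b t 0‖ ≤ κ₁) ∧
  (∀ t : ℝ, 0 ≤ t → ∀ x y : Vec d, ‖b t x - b t y‖ ≤ κ₁ * max (‖x - y‖ ^ β) ‖x - y‖)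

/-- A smooth nonnegative mollifier supported in the closed unit ball with total mass one. -/
structure IsMollifier (d : ℕ) (ρ : Vec d → ℝ) : Prop where
  smooth : ContDiff ℝ (⊤ : ℕ∞) ρ
  nonneg : ∀ x, 0 ≤ ρ x
  support_subset : Function.support ρ ⊆ Metric.closedBall 0 1
  integral_eq_one : ∫ x, ρ x = 1

/-- The spatially mollified drift `b_ε(t,x) = ∫ b(t,y) ρ_ε(x-y) dy`. -/
def mollifiedDrift (d : ℕ) (ρ : Vec d → ℝ) (ε : ℝ) (b : ℝ → Vec d → Vec d)
    (t : ℝ) (x : Vec d) : Vec d :=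
  ∫ y : Vec d, (ε ^ (-(d : ℝ)) * ρ (ε⁻¹ • (x - y))) • b t y

/-- `θ` is the flow of the (time-dependent) vector field `f`:
`θ t s x = x + ∫_s^t f(r, θ r s x) dr` for all nonnegative times. -/
def IsFlow (d : ℕ) (f : ℝ → Vec d → Vec d) (θ : ℝ → ℝ → Vec d → Vec d) : Prop :=
  ∀ s t : ℝ, 0 ≤ s → 0 ≤ t → ∀ x : Vec d,
    θ t s x = x + ∫ r in s..t, f r (θ r s x)

/-- The Gaussian kernel `g_λ(t,x) = t^{-d/2} exp(-λ |x|²/t)`. -/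
def gaussk (d : ℕ) (l t : ℝ) (x : Vec d) : ℝ :=
  t ^ (-(d : ℝ) / 2) * Real.exp (-l * ‖x‖ ^ 2 / t)

/-- A drift which is measurable, bounded at the origin uniformly in time, and Lipschitz in
space with constant `κ` uniformly in time. -/
def LipschitzDrift (d : ℕ) (b : ℝ → Vec d → Vec d) (κ : ℝ) : Prop :=
  Measurable (Function.uncurry b) ∧
  (∃ M : ℝ, ∀ t : ℝ, 0 ≤ t → ‖b t 0‖ ≤ M) ∧
  (∀ t : ℝ, 0 ≤ t → ∀ x y : Vec d, ‖b t x - b t y‖ ≤ κ * ‖x - y‖)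

/-- The diffusion matrix `σσ*`. -/
def sqMat (d : ℕ) (σ : ℝ → Vec d → Matrix (Fin d) (Fin d) ℝ) (t : ℝ) (x : Vec d) :
    Matrix (Fin d) (Fin d) ℝ :=
  σ t x * (σ t x)ᵀ

/-- Hypothesis (H^σ_α): measurability, uniform ellipticity with constant `κ₀`
and spatial α-Hölder continuity with constant `κ₀`. -/
def EllipticHolder (d : ℕ) (σ : ℝ → Vec d → Matrix (Fin d) (Fin d) ℝ) (κ₀ α : ℝ) : Prop :=
  (∀ i j : Fin d, Measurable fun p : ℝ × Vec d => σ p.1 p.2 i j) ∧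
  (∀ t : ℝ, 0 ≤ t → ∀ x : Vec d, ∀ ξ : Fin d → ℝ,
    κ₀⁻¹ * (ξ ⬝ᵥ ξ) ≤ (sqMat d σ t x).mulVec ξ ⬝ᵥ ξ ∧
      (sqMat d σ t x).mulVec ξ ⬝ᵥ ξ ≤ κ₀ * (ξ ⬝ᵥ ξ)) ∧
  (∀ t : ℝ, 0 ≤ t → ∀ x y : Vec d, ∀ i j : Fin d,
    |σ t x i j - σ t y i j| ≤ κ₀ * ‖x - y‖ ^ α)

/-- `b` is smooth in the space variable, with spatial derivatives of every order
bounded uniformly in time and space. -/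
def SmoothVecBounded (d : ℕ) (b : ℝ → Vec d → Vec d) : Prop :=
  (∀ t : ℝ, ContDiff ℝ (⊤ : ℕ∞) (b t)) ∧
  ∀ n : ℕ, 1 ≤ n → ∃ M : ℝ, ∀ t : ℝ, 0 ≤ t → ∀ x : Vec d,
    ‖iteratedFDeriv ℝ n (b t) x‖ ≤ M

/-- `σ` is smooth in the space variable, with spatial derivatives of every order
bounded uniformly in time and space. -/
def SmoothMatBounded (d : ℕ) (σ : ℝ → Vec d → Matrix (Fin d) (Fin d) ℝ) : Prop :=
  (∀ t : ℝ, ∀ i j : Fin d, ContDiff ℝ (⊤ : ℕ∞) fun x => σ t x i j) ∧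
  ∀ n : ℕ, 1 ≤ n → ∃ M : ℝ, ∀ t : ℝ, 0 ≤ t → ∀ x : Vec d, ∀ i j : Fin d,
    ‖iteratedFDeriv ℝ n (fun z => σ t z i j) x‖ ≤ M

/-- The mean shift `ϑ^{(τ,ξ)}_{t,s} = ∫_s^t b(r, θ_{r,τ}(ξ)) dr` of the frozen process. -/
def freezeMean (d : ℕ) (b : ℝ → Vec d → Vec d) (θ : ℝ → ℝ → Vec d → Vec d)
    (τ : ℝ) (ξ : Vec d) (s t : ℝ) : Vec d :=
  ∫ r in s..t, b r (θ r τ ξ)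

/-- The covariance `𝒞^{(τ,ξ)}_{t,s} = ∫_s^t (σσ*)(r, θ_{r,τ}(ξ)) dr` of the frozen process. -/
def freezeCov (d : ℕ) (σ : ℝ → Vec d → Matrix (Fin d) (Fin d) ℝ)
    (θ : ℝ → ℝ → Vec d → Vec d) (τ : ℝ) (ξ : Vec d) (s t : ℝ) :
    Matrix (Fin d) (Fin d) ℝ :=
  Matrix.of fun i j => ∫ r in s..t, sqMat d σ r (θ r τ ξ) i j

/-- The frozen Gaussian density
`p̃^{(τ,ξ)}(s,x,t,y) = ((2π)^d det 𝒞)^{-1/2} exp(−½ ⟨𝒞⁻¹ m, m⟩)`, `m = ϑ + x − y`. -/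
def frozenDensity (d : ℕ) (b : ℝ → Vec d → Vec d)
    (σ : ℝ → Vec d → Matrix (Fin d) (Fin d) ℝ) (θ : ℝ → ℝ → Vec d → Vec d)
    (τ : ℝ) (ξ : Vec d) (s : ℝ) (x : Vec d) (t : ℝ) (y : Vec d) : ℝ :=
  (Real.sqrt ((2 * Real.pi) ^ d * (freezeCov d σ θ τ ξ s t).det))⁻¹ *
    Real.exp (-(1 / 2) *
      ((freezeCov d σ θ τ ξ s t)⁻¹.mulVec (fun i => (freezeMean d b θ τ ξ s t + x - y) i) ⬝ᵥ
        fun i => (freezeMean d b θ τ ξ s t + x - y) i))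

/-- Second spatial derivative `∂²f/∂x_i∂x_j` of a scalar function on `ℝ^d`. -/
def hessEntry (d : ℕ) (f : Vec d → ℝ) (x : Vec d) (i j : Fin d) : ℝ :=
  iteratedFDeriv ℝ 2 f x ![EuclideanSpace.single i (1 : ℝ), EuclideanSpace.single j (1 : ℝ)]

/-- First spatial derivative `∂f/∂x_i` of a scalar function on `ℝ^d`. -/
def gradEntry (d : ℕ) (f : Vec d → ℝ) (x : Vec d) (i : Fin d) : ℝ :=
  fderiv ℝ f x (EuclideanSpace.single i (1 : ℝ))

/-- The parametrix kernel
`H(s,x,t,y) = tr[(a(s,x) − a(s,θ_{s,t}(y))) ∇²_x p̃₁(s,x,t,y)]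
+ ⟨b(s,x) − b(s,θ_{s,t}(y)), ∇_x p̃₁(s,x,t,y)⟩`, where `a = σσ*/2` and
`p̃₁(s,x,t,y) = p̃^{(t,y)}(s,x,t,y)`. -/
def paramKernel (d : ℕ) (b : ℝ → Vec d → Vec d)
    (σ : ℝ → Vec d → Matrix (Fin d) (Fin d) ℝ) (θ : ℝ → ℝ → Vec d → Vec d)
    (s : ℝ) (x : Vec d) (t : ℝ) (y : Vec d) : ℝ :=
  (∑ i, ∑ j, ((1 / 2) * sqMat d σ s x i j - (1 / 2) * sqMat d σ s (θ s t y) i j) *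
      hessEntry d (fun x' => frozenDensity d b σ θ t y s x' t y) x i j) +
    ∑ i, (b s x i - b s (θ s t y) i) *
      gradEntry d (fun x' => frozenDensity d b σ θ t y s x' t y) x i

/-- Space-time convolution `(f ⊗ h)(s,x,t,y) = ∫_s^t ∫ f(s,x,r,z) h(r,z,t,y) dz dr`. -/
def spaceTimeConv (d : ℕ) (f h : ℝ → Vec d → ℝ → Vec d → ℝ)
    (s : ℝ) (x : Vec d) (t : ℝ) (y : Vec d) : ℝ :=
  ∫ r in s..t, ∫ z : Vec d, f s x r z * h r z t y

/-- Iterated kernels: `iterKernel H N = H^{⊗(N+1)}`, i.e. `H^{⊗1} = H` and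
`H^{⊗(N+1)} = H ⊗ H^{⊗N}`. -/
def iterKernel (d : ℕ) (H : ℝ → Vec d → ℝ → Vec d → ℝ) :
    ℕ → ℝ → Vec d → ℝ → Vec d → ℝ
  | 0 => H
  | N + 1 => spaceTimeConv d H (iterKernel d H N)

/-- A function on a set of reals is continuous there if it is continuous on all the segments
with end points in the set. -/
lemma continuousOn_of_forall_uIcc {E : Type*} [TopologicalSpace E] {γ : ℝ → E} {A : Set ℝ}
    (h : ∀ p ∈ A, ∀ q ∈ A, ContinuousOn γ (uIcc p q)) : ContinuousOn γ A := by
  intro r hr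
  have hl : ContinuousWithinAt γ (A ∩ Iic r) r := by
    by_cases hq : ∃ q ∈ A, q < r
    · obtain ⟨q, hq, hqr⟩ := hq
      have := h q hq r hr r right_mem_uIcc
      rw [uIcc_of_le hqr.le] at this
      exact (this.mono_of_mem_nhdsWithin (Icc_mem_nhdsLE hqr)).mono inter_subset_right
    · push Not at hq
      exact (continuousWithinAt_singleton (f := γ) (x := r)).mono
        fun u hu => le_antisymm hu.2 (hq u hu.1)
  have hr : ContinuousWithinAt γ (A ∩ Ici r) r := by
    by_cases hq : ∃ q ∈ A, r < q
    · obtain ⟨q, hq, hqr⟩ := hq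
      have := h r hr q hq r left_mem_uIcc
      rw [uIcc_of_le hqr.le] at this
      exact (this.mono_of_mem_nhdsWithin (Icc_mem_nhdsGE hqr)).mono inter_subset_right
    · push Not at hq
      exact (continuousWithinAt_singleton (f := γ) (x := r)).mono
        fun u hu => le_antisymm (hq u hu.1) hu.2
  refine (hl.union hr).mono fun u hu => ?_
  rcases le_total u r with h | h
  · exact Or.inl ⟨hu, h⟩
  · exact Or.inr ⟨hu, h⟩

/-- Integral Grönwall inequality, forward in time. -/
lemma le_mul_exp_of_le_add_integral {φ : ℝ → ℝ} {a b A K : ℝ} (hab : a ≤ b) (hK : 0 ≤ K)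
    (hφ : ContinuousOn φ (Icc a b)) (h0 : ∀ r ∈ Icc a b, 0 ≤ φ r)
    (h : ∀ r ∈ Icc a b, φ r ≤ A + K * ∫ u in a..r, φ u) :
    φ b ≤ A * Real.exp (K * (b - a)) := by
  have haa : a ∈ Icc a b := left_mem_Icc.2 hab
  have hA : 0 ≤ A := by
    have := (h0 a haa).trans (h a haa)
    simpa using this
  set ψ : ℝ → ℝ := IccExtend hab ((Icc a b).domRestrict φ) with hψ
  have hψc : Continuous ψ := (continuousOn_iff_continuous_domRestrict.1 hφ).Icc_extend'
  have hψφ : ∀ r ∈ Icc a b, ψ r = φ r := fun r hr => by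
    rw [hψ, IccExtend_of_mem hab _ hr]; rfl
  have h_int : ∀ r ∈ Icc a b, ∫ u in a..r, ψ u = ∫ u in a..r, φ u := fun r hr => by
    refine intervalIntegral.integral_congr fun u hu => hψφ u ?_
    rw [uIcc_of_le hr.1] at hu
    exact ⟨hu.1, hu.2.trans hr.2⟩
  have hd : ∀ x, HasDerivAt (fun r => A + K * ∫ u in a..r, ψ u) (K * ψ x) x := fun x =>
    ((hψc.integral_hasStrictDerivAt a x).hasDerivAt.const_mul K).const_add A
  have key := norm_le_gronwallBound_of_norm_deriv_right_le (K := K) (ε := 0) (δ := A)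
    (f := fun r => A + K * ∫ u in a..r, ψ u) (f' := fun r => K * ψ r) (a := a) (b := b)
    (fun x _ => (hd x).continuousAt.continuousWithinAt) (fun x _ => (hd x).hasDerivWithinAt)
    (by simp [abs_of_nonneg hA]) (fun x hx => by
      have hx' := Ico_subset_Icc_self hx
      have h1 := h x hx'
      rw [← h_int x hx', ← hψφ x hx'] at h1
      have h2 : 0 ≤ ψ x := by rw [hψφ x hx']; exact h0 x hx'
      rw [Real.norm_of_nonneg (mul_nonneg hK h2), Real.norm_of_nonneg (h2.trans h1), add_zero]
      exact mul_le_mul_of_nonneg_left h1 hK) b (right_mem_Icc.2 hab)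
  rw [gronwallBound_ε0] at key
  refine (h b (right_mem_Icc.2 hab)).trans ?_
  rw [← h_int b (right_mem_Icc.2 hab)]
  exact (le_abs_self _).trans key

/-- A curve whose velocity grows at most linearly along it grows at most exponentially,
forward in time. -/
lemma norm_curve_le_of_le {E : Type*} [NormedAddCommGroup E] [NormedSpace ℝ E]
    {γ v : ℝ → E} {a b L K : ℝ} (hab : a ≤ b) (hL : 0 ≤ L) (hK : 0 ≤ K)
    (hv : IntervalIntegrable v volume a b)
    (hγ : ∀ r ∈ uIcc a b, γ r = γ a + ∫ u in a..r, v u)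
    (hb : ∀ r ∈ uIcc a b, ‖v r‖ ≤ L + K * ‖γ r‖) :
    ‖γ b‖ ≤ (‖γ a‖ + L * (b - a)) * Real.exp (K * (b - a)) := by
  have hγc : ContinuousOn γ (Icc a b) := by
    rw [← uIcc_of_le hab]
    refine ContinuousOn.congr (f := fun r => γ a + ∫ u in a..r, v u) ?_ hγ
    refine continuousOn_const.add ?_
    exact intervalIntegral.continuousOn_primitive_interval' hv left_mem_uIcc
  rw [uIcc_of_le hab] at hγ hb
  refine le_mul_exp_of_le_add_integral hab hK hγc.norm (fun _ _ => norm_nonneg _)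
    fun r hr => ?_
  have hsub : Icc a r ⊆ Icc a b := Icc_subset_Icc_right hr.2
  have hni : IntervalIntegrable (fun u => ‖γ u‖) volume a r := by
    refine ContinuousOn.intervalIntegrable ?_
    rw [uIcc_of_le hr.1]
    exact (hγc.mono hsub).norm
  have h1 : ‖∫ u in a..r, v u‖ ≤ ∫ u in a..r, (L + K * ‖γ u‖) := by
    refine intervalIntegral.norm_integral_le_of_norm_le hr.1
      (Filter.Eventually.of_forall fun u hu => hb u (hsub (Ioc_subset_Icc_self hu))) ?_
    exact intervalIntegrable_const.add (hni.const_mul K)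
  rw [intervalIntegral.integral_add intervalIntegrable_const (hni.const_mul K),
    intervalIntegral.integral_const, intervalIntegral.integral_const_mul, smul_eq_mul] at h1
  have h2 : (r - a) * L ≤ L * (b - a) := by nlinarith [hr.2]
  calc ‖γ r‖ ≤ ‖γ a‖ + ‖∫ u in a..r, v u‖ := by rw [hγ r hr]; exact norm_add_le _ _
    _ ≤ _ := by linarith

/-- A curve whose velocity grows at most linearly along it grows at most exponentially. -/
lemma norm_curve_le {E : Type*} [NormedAddCommGroup E] [NormedSpace ℝ E]
    {γ v : ℝ → E} {a b L K : ℝ} (hL : 0 ≤ L) (hK : 0 ≤ K)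
    (hv : IntervalIntegrable v volume a b)
    (hγ : ∀ r ∈ uIcc a b, γ r = γ a + ∫ u in a..r, v u)
    (hb : ∀ r ∈ uIcc a b, ‖v r‖ ≤ L + K * ‖γ r‖) :
    ‖γ b‖ ≤ (‖γ a‖ + L * |b - a|) * Real.exp (K * |b - a|) := by
  rcases le_total a b with hab | hab
  · rw [abs_of_nonneg (sub_nonneg.2 hab)]
    exact norm_curve_le_of_le hab hL hK hv hγ hb
  · have hmem : ∀ r, r ∈ uIcc (-a) (-b) → -r ∈ uIcc a b := fun r hr => by
      rw [uIcc_of_le (neg_le_neg hab)] at hr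
      rw [uIcc_of_ge hab]
      exact ⟨by linarith [hr.2], by linarith [hr.1]⟩
    have key := norm_curve_le_of_le (γ := fun r => γ (-r)) (v := fun r => -v (-r))
      (a := -a) (b := -b) (L := L) (K := K) (neg_le_neg hab) hL hK
      (by have := (hv.comp_sub_left 0).neg; simp only [zero_sub] at this; exact this)
      (fun r hr => by
        simp only [neg_neg]
        rw [hγ (-r) (hmem r hr), intervalIntegral.integral_neg,
          intervalIntegral.integral_comp_neg (fun u => v u), neg_neg,
          intervalIntegral.integral_symm])
      (fun r hr => by simpa using hb (-r) (hmem r hr))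
    rw [abs_of_nonpos (sub_nonpos.2 hab)]
    simpa [neg_add_eq_sub, add_comm, sub_eq_add_neg] using key

lemma IsFlow.self {d : ℕ} {f : ℝ → Vec d → Vec d} {θ : ℝ → ℝ → Vec d → Vec d}
    (hθ : IsFlow d f θ) {s : ℝ} (hs : 0 ≤ s) (x : Vec d) : θ s s x = x := by
  simpa using hθ s s hs hs x

/-- Along a flow of a measurable field of linear growth the velocity is integrable. -/
lemma IsFlow.intervalIntegrable {d : ℕ} {f : ℝ → Vec d → Vec d} {θ : ℝ → ℝ → Vec d → Vec d}
    (hθ : IsFlow d f θ) (hf : Measurable (Function.uncurry f)) {L K : ℝ} (hL : 0 ≤ L)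
    (hK : 0 ≤ K) (hg : ∀ t, 0 ≤ t → ∀ x, ‖f t x‖ ≤ L + K * ‖x‖) {s t : ℝ} (hs : 0 ≤ s)
    (ht : 0 ≤ t) (x : Vec d) :
    IntervalIntegrable (fun r => f r (θ r s x)) volume s t := by
  set γ : ℝ → Vec d := fun r => θ r s x with hγ
  set v : ℝ → Vec d := fun r => f r (γ r) with hv
  have hflow : ∀ r, 0 ≤ r → γ r = γ s + ∫ u in s..r, v u := fun r hr => by
    have := hθ s r hs hr x
    rw [hγ]; simp only
    rw [hθ.self hs x]; exact this
  have hnonneg : ∀ r₁, 0 ≤ r₁ → ∀ r ∈ uIcc s r₁, 0 ≤ r := fun r₁ h₁ r hr =>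
    (le_min hs h₁).trans hr.1
  set A : Set ℝ := {r | r ∈ uIcc s t ∧ IntervalIntegrable v volume s r} with hA
  have hsub : ∀ r ∈ A, uIcc s r ⊆ A := fun r hr u hu =>
    ⟨uIcc_subset_uIcc_left hr.1 hu, hr.2.mono_set (uIcc_subset_uIcc_left hu)⟩
  have hAord : A.OrdConnected := by
    refine ⟨fun p hp q hq u hu => ?_⟩
    rcases le_total s u with h | h
    · exact hsub q hq (by rw [uIcc_of_le (h.trans hu.2)]; exact ⟨h, hu.2⟩)
    · exact hsub p hp (by rw [uIcc_of_ge (hu.1.trans h)]; exact ⟨hu.1, h⟩)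
  have hAm : MeasurableSet A := hAord.measurableSet
  have hcont : ContinuousOn γ A := by
    refine continuousOn_of_forall_uIcc fun p hp q hq => ?_
    have hpq : IntervalIntegrable v volume p q := hp.2.symm.trans hq.2
    have hc : ContinuousOn (fun r => γ p + ∫ u in p..r, v u) (uIcc p q) :=
      continuousOn_const.add (intervalIntegral.continuousOn_primitive_interval' hpq left_mem_uIcc)
    refine hc.congr fun r hr => ?_
    have hrA : r ∈ A := hAord.uIcc_subset hp hq hr
    beta_reduce
    rw [hflow r (hnonneg t ht r hrA.1), hflow p (hnonneg t ht p hp.1), add_assoc,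
      intervalIntegral.integral_add_adjacent_intervals hp.2 (hp.2.symm.trans hrA.2)]
  have hbound : ∀ r ∈ uIcc s t, ‖γ r‖ ≤ (‖γ s‖ + L * |t - s|) * Real.exp (K * |t - s|) := by
    intro r hr
    have hrs : |r - s| ≤ |t - s| := abs_sub_left_of_mem_uIcc hr
    by_cases hi : IntervalIntegrable v volume s r
    · have h0 := hnonneg t ht r hr
      refine (norm_curve_le hL hK hi (fun u hu => hflow u (hnonneg r h0 u hu))
        (fun u hu => hg u (hnonneg r h0 u hu) _)).trans ?_
      gcongr
    · have : γ r = γ s := by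
        rw [hflow r (hnonneg t ht r hr), intervalIntegral.integral_undef hi, add_zero]
      rw [this]
      have h1 : 0 ≤ L * |t - s| := by positivity
      have h2 : 1 ≤ Real.exp (K * |t - s|) := Real.one_le_exp (by positivity)
      nlinarith [norm_nonneg (γ s)]
  have hγm : AEMeasurable γ (volume.restrict (uIoc s t)) := by
    have h1 : AEMeasurable γ (volume.restrict A) := hcont.aemeasurable hAm
    have h2 : AEMeasurable γ (volume.restrict (uIcc s t \ A)) := by
      refine AEMeasurable.congr (aemeasurable_const (b := γ s)) ?_
      filter_upwards [ae_restrict_mem (measurableSet_uIcc.diff hAm)] with r hr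
      have hi : ¬ IntervalIntegrable v volume s r := fun h => hr.2 ⟨hr.1, h⟩
      rw [hflow r (hnonneg t ht r hr.1), intervalIntegral.integral_undef hi, add_zero]
    have h3 : AEMeasurable γ (volume.restrict (A ∪ (uIcc s t \ A))) :=
      aemeasurable_union_iff.2 ⟨h1, h2⟩
    refine h3.mono_set fun r hr => ?_
    have := uIoc_subset_uIcc hr
    by_cases h : r ∈ A
    · exact Or.inl h
    · exact Or.inr ⟨this, h⟩
  have hvm : AEStronglyMeasurable v (volume.restrict (uIoc s t)) :=
    (hf.comp_aemeasurable (aemeasurable_id.prodMk hγm)).aestronglyMeasurable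
  rw [intervalIntegrable_iff]
  refine IntegrableOn.of_bound (by simp [uIoc]) hvm
    (L + K * ((‖γ s‖ + L * |t - s|) * Real.exp (K * |t - s|))) ?_
  filter_upwards [ae_restrict_mem measurableSet_uIoc] with r hr
  have hr' := uIoc_subset_uIcc hr
  refine (hg r (hnonneg t ht r hr') _).trans ?_
  gcongr
  exact hbound r hr'

lemma IsFlow.eq_add_integral {d : ℕ} {f : ℝ → Vec d → Vec d} {θ : ℝ → ℝ → Vec d → Vec d}
    (hθ : IsFlow d f θ) (hf : Measurable (Function.uncurry f)) {L K : ℝ} (hL : 0 ≤ L)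
    (hK : 0 ≤ K) (hg : ∀ t, 0 ≤ t → ∀ x, ‖f t x‖ ≤ L + K * ‖x‖) {s r t : ℝ} (hs : 0 ≤ s)
    (hr : 0 ≤ r) (ht : 0 ≤ t) (x : Vec d) :
    θ t s x = θ r s x + ∫ u in r..t, f u (θ u s x) := by
  have h1 := hθ.intervalIntegrable hf hL hK hg hs hr x
  have h2 := hθ.intervalIntegrable hf hL hK hg hs ht x
  rw [hθ s t hs ht x, hθ s r hs hr x, add_assoc,
    intervalIntegral.integral_add_adjacent_intervals h1 (h1.symm.trans h2)]

/-- Two trajectories of fields which differ by at most `L + K ‖x - y‖` remain comparable. -/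
lemma IsFlow.norm_sub_le {d : ℕ} {f g : ℝ → Vec d → Vec d} {θ η : ℝ → ℝ → Vec d → Vec d}
    (hθ : IsFlow d f θ) (hη : IsFlow d g η) (hf : Measurable (Function.uncurry f))
    (hg : Measurable (Function.uncurry g)) {M L K : ℝ} (hM : 0 ≤ M) (hL : 0 ≤ L) (hK : 0 ≤ K)
    (hfM : ∀ t, 0 ≤ t → ∀ x, ‖f t x‖ ≤ M + M * ‖x‖)
    (hgM : ∀ t, 0 ≤ t → ∀ x, ‖g t x‖ ≤ M + M * ‖x‖)
    (hfg : ∀ t, 0 ≤ t → ∀ x y, ‖f t x - g t y‖ ≤ L + K * ‖x - y‖)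
    {s t : ℝ} (hs : 0 ≤ s) (ht : 0 ≤ t) (x y : Vec d) {p q : ℝ} (hp : 0 ≤ p) (hq : 0 ≤ q) :
    ‖θ q s x - η q t y‖ ≤
      (‖θ p s x - η p t y‖ + L * |q - p|) * Real.exp (K * |q - p|) := by
  have hi : ∀ a b, 0 ≤ a → 0 ≤ b → IntervalIntegrable (fun r => f r (θ r s x)) volume a b :=
    fun a b ha hb => (hθ.intervalIntegrable hf hM hM hfM hs ha x).symm.trans
      (hθ.intervalIntegrable hf hM hM hfM hs hb x)
  have hj : ∀ a b, 0 ≤ a → 0 ≤ b → IntervalIntegrable (fun r => g r (η r t y)) volume a b :=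
    fun a b ha hb => (hη.intervalIntegrable hg hM hM hgM ht ha y).symm.trans
      (hη.intervalIntegrable hg hM hM hgM ht hb y)
  refine norm_curve_le (γ := fun r => θ r s x - η r t y)
    (v := fun r => f r (θ r s x) - g r (η r t y)) hL hK ((hi p q hp hq).sub (hj p q hp hq))
    (fun r hr => ?_) (fun r hr => hfg r ((le_min hp hq).trans hr.1) _ _)
  have hr0 : 0 ≤ r := (le_min hp hq).trans hr.1
  rw [intervalIntegral.integral_sub (hi p r hp hr0) (hj p r hp hr0),
    hθ.eq_add_integral hf hM hM hfM hs hp hr0 x, hη.eq_add_integral hg hM hM hgM ht hp hr0 y]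
  abel

lemma HolderDrift.norm_sub_le {d : ℕ} {b : ℝ → Vec d → Vec d} {κ₁ : ℝ} (hκ₁ : 0 ≤ κ₁)
    (hb : HolderDrift d b κ₁ 0) {t : ℝ} (ht : 0 ≤ t) (x y : Vec d) :
    ‖b t x - b t y‖ ≤ κ₁ + κ₁ * ‖x - y‖ := by
  refine (hb.2.2 t ht x y).trans ?_
  rw [Real.rpow_zero]
  have : max 1 ‖x - y‖ ≤ 1 + ‖x - y‖ :=
    max_le (by linarith [norm_nonneg (x - y)]) (by linarith)
  nlinarith

lemma HolderDrift.norm_le {d : ℕ} {b : ℝ → Vec d → Vec d} {κ₁ : ℝ} (hκ₁ : 0 ≤ κ₁)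
    (hb : HolderDrift d b κ₁ 0) {t : ℝ} (ht : 0 ≤ t) (x : Vec d) :
    ‖b t x‖ ≤ 2 * κ₁ + κ₁ * ‖x‖ := by
  have h1 := hb.norm_sub_le hκ₁ ht x 0
  rw [sub_zero] at h1
  have h2 := hb.2.1 t ht
  have h3 : ‖b t x‖ ≤ ‖b t x - b t 0‖ + ‖b t 0‖ := by
    simpa using norm_add_le (b t x - b t 0) (b t 0)
  linarith

lemma measurable_mollifiedDrift {d : ℕ} {ρ : Vec d → ℝ} (hρ : IsMollifier d ρ)
    {b : ℝ → Vec d → Vec d} (hb : Measurable (Function.uncurry b)) :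
    Measurable (Function.uncurry (mollifiedDrift d ρ 1 b)) := by
  have hρm : Measurable ρ := hρ.smooth.continuous.measurable
  have h : Measurable (fun p : (ℝ × Vec d) × Vec d =>
      ((1 : ℝ) ^ (-(d : ℝ)) * ρ ((1 : ℝ)⁻¹ • (p.1.2 - p.2))) • b p.1.1 p.2) := by
    have h1 : Measurable (fun p : (ℝ × Vec d) × Vec d => b p.1.1 p.2) :=
      hb.comp (by fun_prop : Measurable fun p : (ℝ × Vec d) × Vec d => (p.1.1, p.2))
    have h2 : Measurable (fun p : (ℝ × Vec d) × Vec d => ρ ((1 : ℝ)⁻¹ • (p.1.2 - p.2))) :=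
      hρm.comp (by fun_prop)
    exact (h2.const_mul _).smul h1
  exact (h.stronglyMeasurable.integral_prod_right' (ν := volume)).measurable

lemma norm_mollifiedDrift_sub_le {d : ℕ} {ρ : Vec d → ℝ} (hρ : IsMollifier d ρ)
    {b : ℝ → Vec d → Vec d} {κ₁ : ℝ} (hb : HolderDrift d b κ₁ 0) {t : ℝ} (ht : 0 ≤ t)
    (x : Vec d) : ‖mollifiedDrift d ρ 1 b t x - b t x‖ ≤ κ₁ := by
  have hρi : Integrable (fun y => ρ (x - y)) :=
    (integrable_of_integral_eq_one hρ.integral_eq_one).comp_sub_left x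
  have hρ1 : ∫ y, ρ (x - y) = 1 := by
    rw [integral_sub_left_eq_self ρ volume x, hρ.integral_eq_one]
  have hbm : Measurable (b t) := hb.1.comp (measurable_const.prodMk measurable_id)
  have hle : ∀ y, ‖ρ (x - y) • (b t y - b t x)‖ ≤ κ₁ * ρ (x - y) := fun y => by
    rw [norm_smul, Real.norm_of_nonneg (hρ.nonneg _), mul_comm]
    rcases eq_or_ne (ρ (x - y)) 0 with h0 | h0
    · simp [h0]
    · have hxy : ‖y - x‖ ≤ 1 := by
        have := hρ.support_subset h0
        rw [norm_sub_rev]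
        simpa using this
      refine mul_le_mul_of_nonneg_right ?_ (hρ.nonneg _)
      have := hb.2.2 t ht y x
      rwa [Real.rpow_zero, max_eq_left hxy, mul_one] at this
  have hgi : Integrable (fun y => ρ (x - y) • (b t y - b t x)) := by
    refine (hρi.const_mul κ₁).mono' ?_ (Filter.Eventually.of_forall hle)
    exact hρi.aestronglyMeasurable.smul
      (hbm.aestronglyMeasurable.sub aestronglyMeasurable_const)
  have hsplit : mollifiedDrift d ρ 1 b t x =
      (∫ y, ρ (x - y) • (b t y - b t x)) + ∫ y, ρ (x - y) • b t x := by
    rw [← integral_add hgi (hρi.smul_const _)]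
    simp [mollifiedDrift, smul_sub]
  rw [hsplit, integral_smul_const, hρ1, one_smul, add_sub_cancel_right]
  refine (norm_integral_le_of_norm_le (hρi.const_mul κ₁)
    (Filter.Eventually.of_forall hle)).trans ?_
  rw [integral_const_mul, hρ1, mul_one]

/-- Trajectories of the mollified and of the original drift remain comparable. -/
lemma norm_mollifiedFlow_sub_flow_le {d : ℕ} {ρ : Vec d → ℝ} (hρ : IsMollifier d ρ)
    {b : ℝ → Vec d → Vec d} {κ₁ : ℝ} (hκ₁ : 0 ≤ κ₁) (hb : HolderDrift d b κ₁ 0)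
    {θ θ1 : ℝ → ℝ → Vec d → Vec d} (hθ : IsFlow d b θ)
    (hθ1 : IsFlow d (mollifiedDrift d ρ 1 b) θ1) {s t : ℝ} (hs : 0 ≤ s) (ht : 0 ≤ t)
    (x y : Vec d) {p q : ℝ} (hp : 0 ≤ p) (hq : 0 ≤ q) :
    ‖θ1 q s x - θ q t y‖ ≤
      (‖θ1 p s x - θ p t y‖ + 2 * κ₁ * |q - p|) * Real.exp (κ₁ * |q - p|) := by
  have hle : ∀ t, 0 ≤ t → ∀ x y,
      ‖mollifiedDrift d ρ 1 b t x - b t y‖ ≤ 2 * κ₁ + κ₁ * ‖x - y‖ := fun t ht x y => by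
    have h1 := norm_mollifiedDrift_sub_le hρ hb ht x
    have h2 := hb.norm_sub_le hκ₁ ht x y
    have h3 := norm_add_le (mollifiedDrift d ρ 1 b t x - b t x) (b t x - b t y)
    rw [sub_add_sub_cancel] at h3
    linarith
  refine hθ1.norm_sub_le hθ (measurable_mollifiedDrift hρ hb.1) hb.1 (M := 3 * κ₁)
    (by positivity) (by positivity) hκ₁ (fun t ht x => ?_) (fun t ht x => ?_) hle hs ht x y hp hq
  · have h1 := norm_mollifiedDrift_sub_le hρ hb ht x
    have h2 := hb.norm_le hκ₁ ht x
    have h3 := norm_add_le (mollifiedDrift d ρ 1 b t x - b t x) (b t x)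
    rw [sub_add_cancel] at h3
    nlinarith [norm_nonneg x]
  · have h2 := hb.norm_le hκ₁ ht x
    nlinarith [norm_nonneg x]

section GaussianDerivatives

variable {E : Type*} [NormedAddCommGroup E] [InnerProductSpace ℝ E]

lemma hasFDerivAt_gaussian (L : E →L[ℝ] E) (hL : ∀ u v, inner ℝ (L u) v = inner ℝ u (L v))
    (c : ℝ) (m x : E) :
    HasFDerivAt (fun x => c * Real.exp (-(1 / 2) * inner ℝ (L (x - m)) (x - m)))
      (-(c * Real.exp (-(1 / 2) * inner ℝ (L (x - m)) (x - m))) •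
        innerSL ℝ (L (x - m))) x := by
  have h1 : HasFDerivAt (fun x : E => x - m) (ContinuousLinearMap.id ℝ E) x :=
    (hasFDerivAt_id x).sub_const m
  have h2 : HasFDerivAt (fun x : E => L (x - m)) L x := by
    exact L.hasFDerivAt.comp x h1
  have h3 := (((h2.inner ℝ h1).const_mul (-(1 / 2))).exp).const_mul c
  refine h3.congr_fderiv ?_
  ext v
  simp only [_root_.smul_apply, ContinuousLinearMap.comp_apply,
    ContinuousLinearMap.prod_apply, fderivInnerCLM_apply, ContinuousLinearMap.id_apply,
    innerSL_apply_apply, smul_eq_mul]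
  rw [hL v, real_inner_comm (L (x - m)) v]
  ring

lemma fderiv_gaussian_apply (L : E →L[ℝ] E)
    (hL : ∀ u v, inner ℝ (L u) v = inner ℝ u (L v)) (c : ℝ) (m x u : E) :
    fderiv ℝ (fun x => c * Real.exp (-(1 / 2) * inner ℝ (L (x - m)) (x - m))) x u =
      -(c * Real.exp (-(1 / 2) * inner ℝ (L (x - m)) (x - m))) * inner ℝ (L (x - m)) u := by
  rw [(hasFDerivAt_gaussian L hL c m x).fderiv]
  simp only [_root_.smul_apply, innerSL_apply_apply, smul_eq_mul]

lemma iteratedFDeriv_two_gaussian_apply (L : E →L[ℝ] E)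
    (hL : ∀ u v, inner ℝ (L u) v = inner ℝ u (L v)) (c : ℝ) (m x u v : E) :
    iteratedFDeriv ℝ 2 (fun x => c * Real.exp (-(1 / 2) * inner ℝ (L (x - m)) (x - m))) x
        ![u, v] =
      c * Real.exp (-(1 / 2) * inner ℝ (L (x - m)) (x - m)) *
        (inner ℝ (L (x - m)) u * inner ℝ (L (x - m)) v - inner ℝ (L u) v) := by
  have h0 : fderiv ℝ (fun x => c * Real.exp (-(1 / 2) * inner ℝ (L (x - m)) (x - m))) =
      fun x => -(c * Real.exp (-(1 / 2) * inner ℝ (L (x - m)) (x - m))) •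
        innerSL ℝ (L (x - m)) :=
    funext fun x => (hasFDerivAt_gaussian L hL c m x).fderiv
  have h1 : HasFDerivAt (fun x : E => innerSL ℝ (L (x - m))) ((innerSL ℝ).comp L) x := by
    exact ((innerSL ℝ).comp L).hasFDerivAt.comp x ((hasFDerivAt_id x).sub_const m)
  have h2 := (hasFDerivAt_gaussian L hL c m x).neg.smul h1
  rw [iteratedFDeriv_two_apply, h0]
  erw [h2.fderiv]
  simp only [Pi.neg_apply, _root_.add_apply, _root_.smul_apply,
    ContinuousLinearMap.comp_apply, ContinuousLinearMap.smulRight_apply, _root_.neg_apply,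
    innerSL_apply_apply, smul_eq_mul, Matrix.cons_val_zero, Matrix.cons_val_one]
  ring

end GaussianDerivatives

section EllipticMatrix

variable {d : ℕ} {C : Matrix (Fin d) (Fin d) ℝ} {lo hi : ℝ}

lemma dotProduct_ofLp_self (x : Vec d) : x.ofLp ⬝ᵥ x.ofLp = ‖x‖ ^ 2 := by
  rw [← real_inner_self_eq_norm_sq, EuclideanSpace.inner_eq_star_dotProduct]
  simp

lemma pow_le_det_of_elliptic (hC : C.IsSymm) (hlo : 0 ≤ lo)
    (h : ∀ ξ : Fin d → ℝ, lo * (ξ ⬝ᵥ ξ) ≤ C.mulVec ξ ⬝ᵥ ξ) : lo ^ d ≤ C.det := by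
  have hH : C.IsHermitian := by rw [IsHermitian, conjTranspose_eq_transpose_of_trivial]; exact hC
  rw [hH.det_eq_prod_eigenvalues]
  have hle : ∀ i, lo ≤ hH.eigenvalues i := fun i => by
    set e := hH.eigenvectorBasis i with he
    have h1 := h e.ofLp
    rw [hH.mulVec_eigenvectorBasis i, ← he, smul_dotProduct, dotProduct_ofLp_self,
      (hH.eigenvectorBasis.orthonormal.1 i : ‖e‖ = 1)] at h1
    simpa using h1
  calc lo ^ d = ∏ _i : Fin d, lo := by simp
    _ ≤ ∏ i, hH.eigenvalues i := Finset.prod_le_prod (fun _ _ => hlo) fun i _ => hle i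

/-- The inverse of a symmetric matrix with spectrum in `[lo, hi]`, as an operator. -/
lemma elliptic_inv_bounds (hC : C.IsSymm) (hlo : 0 < lo) (hhi : 0 < hi)
    (h : ∀ ξ : Fin d → ℝ, lo * (ξ ⬝ᵥ ξ) ≤ C.mulVec ξ ⬝ᵥ ξ ∧ C.mulVec ξ ⬝ᵥ ξ ≤ hi * (ξ ⬝ᵥ ξ)) :
    (∀ u v : Vec d, inner ℝ (toEuclideanCLM (𝕜 := ℝ) C⁻¹ u) v =
      inner ℝ u (toEuclideanCLM (𝕜 := ℝ) C⁻¹ v)) ∧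
    (∀ w : Vec d, ‖toEuclideanCLM (𝕜 := ℝ) C⁻¹ w‖ ≤ lo⁻¹ * ‖w‖) ∧
    (∀ w : Vec d, ‖w‖ ^ 2 ≤ hi * inner ℝ (toEuclideanCLM (𝕜 := ℝ) C⁻¹ w) w) := by
  have hdet : IsUnit C.det :=
    ((pow_pos hlo d).trans_le (pow_le_det_of_elliptic hC hlo.le fun ξ => (h ξ).1)).ne'.isUnit
  set Λ : Vec d →L[ℝ] Vec d := toEuclideanCLM (𝕜 := ℝ) C with hΛ
  set L : Vec d →L[ℝ] Vec d := toEuclideanCLM (𝕜 := ℝ) C⁻¹ with hL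
  have hsymm : ∀ M : Matrix (Fin d) (Fin d) ℝ, M.IsSymm → ∀ u v : Vec d,
      inner ℝ (toEuclideanCLM (𝕜 := ℝ) M u) v =
        inner ℝ u (toEuclideanCLM (𝕜 := ℝ) M v) := fun M hM u v => by
    rw [real_inner_comm, inner_toEuclideanCLM, inner_toEuclideanCLM, dotProduct_mulVec,
      ← mulVec_transpose, hM.eq, dotProduct_comm]
  have hΛL : ∀ w, Λ (L w) = w := fun w => by
    rw [← mul_apply_eq_comp, hΛ, hL, ← map_mul, mul_nonsing_inv _ hdet, map_one,
      one_apply_eq_self]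
  have hquad : ∀ w : Vec d, lo * ‖w‖ ^ 2 ≤ inner ℝ (Λ w) w ∧
      inner ℝ (Λ w) w ≤ hi * ‖w‖ ^ 2 := fun w => by
    have h1 := h w.ofLp
    rw [dotProduct_ofLp_self] at h1
    rw [real_inner_comm, inner_toEuclideanCLM, dotProduct_comm]
    exact h1
  refine ⟨hsymm _ ?_, fun w => ?_, fun w => ?_⟩
  · rw [IsSymm, transpose_nonsing_inv, hC.eq]
  · have h1 := (hquad (L w)).1
    rw [hΛL] at h1
    have h2 := real_inner_le_norm w (L w)
    rw [inv_mul_eq_div, le_div_iff₀ hlo]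
    rcases eq_or_lt_of_le (norm_nonneg (L w)) with h0 | h0
    · rw [← h0]; simp
    · nlinarith
  · have h1 := (hquad (L w - hi⁻¹ • w)).1
    have h1' : 0 ≤ inner ℝ (Λ (L w - hi⁻¹ • w)) (L w - hi⁻¹ • w) :=
      (by positivity : 0 ≤ lo * ‖L w - hi⁻¹ • w‖ ^ 2).trans h1
    have h2 := (hquad w).2
    have h3 : inner ℝ (Λ w) (L w) = ‖w‖ ^ 2 := by
      rw [hsymm C hC, ← hΛ, hΛL, real_inner_self_eq_norm_sq]
    rw [map_sub, map_smul, hΛL, inner_sub_left, inner_sub_right, inner_sub_right,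
      inner_smul_left, inner_smul_left, inner_smul_right, inner_smul_right, h3,
      real_inner_self_eq_norm_sq, real_inner_comm (L w) w] at h1'
    simp only [conj_trivial] at h1'
    have h4 : hi⁻¹ * (hi⁻¹ * inner ℝ (Λ w) w) ≤ hi⁻¹ * ‖w‖ ^ 2 := by
      refine mul_le_mul_of_nonneg_left ?_ (inv_nonneg.2 hhi.le)
      rw [inv_mul_le_iff₀ hhi]
      exact h2
    have h5 : hi⁻¹ * ‖w‖ ^ 2 ≤ inner ℝ (L w) w := by linarith
    rwa [inv_mul_le_iff₀ hhi] at h5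

end EllipticMatrix

section Coefficients

variable {d : ℕ} {σ : ℝ → Vec d → Matrix (Fin d) (Fin d) ℝ} {κ₀ α : ℝ}

lemma EllipticHolder.abs_entry_le (hκ₀ : 1 ≤ κ₀) (hσ : EllipticHolder d σ κ₀ α) {t : ℝ}
    (ht : 0 ≤ t) (x : Vec d) (i k : Fin d) : |σ t x i k| ≤ κ₀ := by
  have h := (hσ.2.1 t ht x (Pi.single i 1)).2
  simp only [mulVec_single_one, dotProduct_single_one, Matrix.col_apply, Pi.single_eq_same,
    mul_one, sqMat, mul_apply, transpose_apply] at h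
  have h1 : σ t x i k * σ t x i k ≤ ∑ j, σ t x i j * σ t x i j :=
    Finset.single_le_sum (f := fun j => σ t x i j * σ t x i j)
      (fun j _ => mul_self_nonneg _) (Finset.mem_univ k)
  exact abs_le_of_sq_le_sq (by nlinarith) (by linarith)

lemma EllipticHolder.abs_sqMat_le (hκ₀ : 1 ≤ κ₀) (hσ : EllipticHolder d σ κ₀ α) {t : ℝ}
    (ht : 0 ≤ t) (x : Vec d) (i j : Fin d) : |sqMat d σ t x i j| ≤ d * κ₀ ^ 2 := by
  rw [sqMat, mul_apply]
  refine (Finset.abs_sum_le_sum_abs _ _).trans ?_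
  calc ∑ k, |σ t x i k * (σ t x)ᵀ k j| ≤ ∑ _k : Fin d, κ₀ ^ 2 := by
        refine Finset.sum_le_sum fun k _ => ?_
        rw [abs_mul, transpose_apply, sq]
        exact mul_le_mul (hσ.abs_entry_le hκ₀ ht x i k) (hσ.abs_entry_le hκ₀ ht x j k)
          (abs_nonneg _) (by linarith)
    _ = d * κ₀ ^ 2 := by simp

lemma EllipticHolder.abs_sqMat_sub_le (hκ₀ : 1 ≤ κ₀) (hσ : EllipticHolder d σ κ₀ α) {t : ℝ}
    (ht : 0 ≤ t) (x y : Vec d) (i j : Fin d) :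
    |sqMat d σ t x i j - sqMat d σ t y i j| ≤ d * (2 * κ₀ ^ 2 * ‖x - y‖ ^ α) := by
  rw [sqMat, sqMat, mul_apply, mul_apply, ← Finset.sum_sub_distrib]
  refine (Finset.abs_sum_le_sum_abs _ _).trans ?_
  calc ∑ k, |σ t x i k * (σ t x)ᵀ k j - σ t y i k * (σ t y)ᵀ k j|
      ≤ ∑ _k : Fin d, 2 * κ₀ ^ 2 * ‖x - y‖ ^ α := by
        refine Finset.sum_le_sum fun k _ => ?_
        rw [transpose_apply, transpose_apply]
        have h1 := hσ.abs_entry_le hκ₀ ht x i k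
        have h2 := hσ.abs_entry_le hκ₀ ht y j k
        have h3 := hσ.2.2 t ht x y j k
        have h4 := hσ.2.2 t ht x y i k
        have e : σ t x i k * σ t x j k - σ t y i k * σ t y j k =
          σ t x i k * (σ t x j k - σ t y j k) + (σ t x i k - σ t y i k) * σ t y j k := by ring
        rw [e]
        refine (abs_add_le _ _).trans ?_
        rw [abs_mul, abs_mul]
        have h5 : |σ t x i k| * |σ t x j k - σ t y j k| ≤ κ₀ * (κ₀ * ‖x - y‖ ^ α) :=
          mul_le_mul h1 h3 (abs_nonneg _) (by linarith)
        have h6 : |σ t x i k - σ t y i k| * |σ t y j k| ≤ κ₀ * ‖x - y‖ ^ α * κ₀ :=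
          mul_le_mul h4 h2 (abs_nonneg _) (by positivity)
        linarith
    _ = d * (2 * κ₀ ^ 2 * ‖x - y‖ ^ α) := by simp

lemma EllipticHolder.measurable_sqMat (hσ : EllipticHolder d σ κ₀ α) (i j : Fin d) :
    Measurable fun p : ℝ × Vec d => sqMat d σ p.1 p.2 i j := by
  simp only [sqMat, mul_apply, transpose_apply]
  exact Finset.measurable_sum _ fun k _ => (hσ.1 i k).mul (hσ.1 j k)

end Coefficients

section Frozen

variable {d : ℕ} {σ : ℝ → Vec d → Matrix (Fin d) (Fin d) ℝ} {b : ℝ → Vec d → Vec d}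
  {θ : ℝ → ℝ → Vec d → Vec d} {κ₀ α κ₁ : ℝ}

lemma freezeCov_isSymm (τ : ℝ) (ξ : Vec d) (s t : ℝ) : (freezeCov d σ θ τ ξ s t).IsSymm := by
  ext i j
  simp [freezeCov, sqMat, mul_apply, mul_comm]

lemma intervalIntegrable_sqMat_flow (hκ₀ : 1 ≤ κ₀) (hκ₁ : 0 ≤ κ₁)
    (hσ : EllipticHolder d σ κ₀ α) (hb : HolderDrift d b κ₁ 0) (hθ : IsFlow d b θ) {s t : ℝ}
    (hs : 0 ≤ s) (ht : 0 ≤ t) (y : Vec d) (i j : Fin d) :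
    IntervalIntegrable (fun r => sqMat d σ r (θ r t y) i j) volume s t := by
  have hi := (hθ.intervalIntegrable hb.1 (by positivity) hκ₁ (fun t ht x => hb.norm_le hκ₁ ht x)
    ht hs y).symm
  have hnonneg : ∀ r ∈ uIcc s t, 0 ≤ r := fun r hr => (le_min hs ht).trans hr.1
  have hc : ContinuousOn (fun r => θ r t y) (uIcc s t) := by
    refine ContinuousOn.congr (f := fun r => y + ∫ u in t..r, b u (θ u t y)) ?_
      fun r hr => hθ t r ht (hnonneg r hr) y
    exact continuousOn_const.add
      (intervalIntegral.continuousOn_primitive_interval' hi right_mem_uIcc)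
  have hm : AEMeasurable (fun r => θ r t y) (volume.restrict (uIoc s t)) :=
    (hc.aemeasurable measurableSet_uIcc).mono_set uIoc_subset_uIcc
  rw [intervalIntegrable_iff]
  refine IntegrableOn.of_bound (by simp [uIoc])
    ((hσ.measurable_sqMat i j).comp_aemeasurable
      (aemeasurable_id.prodMk hm)).aestronglyMeasurable (d * κ₀ ^ 2) ?_
  filter_upwards [ae_restrict_mem measurableSet_uIoc] with r hr
  exact hσ.abs_sqMat_le hκ₀ (hnonneg r (uIoc_subset_uIcc hr)) _ i j

lemma freezeCov_bounds (hκ₀ : 1 ≤ κ₀) (hκ₁ : 0 ≤ κ₁)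
    (hσ : EllipticHolder d σ κ₀ α) (hb : HolderDrift d b κ₁ 0) (hθ : IsFlow d b θ) {s t : ℝ}
    (hs : 0 ≤ s) (hst : s ≤ t) (y : Vec d) (ξ : Fin d → ℝ) :
    (t - s) / κ₀ * (ξ ⬝ᵥ ξ) ≤ (freezeCov d σ θ t y s t).mulVec ξ ⬝ᵥ ξ ∧
      (freezeCov d σ θ t y s t).mulVec ξ ⬝ᵥ ξ ≤ κ₀ * (t - s) * (ξ ⬝ᵥ ξ) := by
  have ht := hs.trans hst
  have hi := fun i j => intervalIntegrable_sqMat_flow hκ₀ hκ₁ hσ hb hθ hs ht y i j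
  have hij : ∀ i j, IntervalIntegrable (fun r => sqMat d σ r (θ r t y) i j * ξ j * ξ i)
      volume s t := fun i j => ((hi i j).mul_const _).mul_const _
  have hsum : ∀ i, IntervalIntegrable (fun r => ∑ j, sqMat d σ r (θ r t y) i j * ξ j * ξ i)
      volume s t := fun i => by
    simpa only [Finset.sum_fn] using IntervalIntegrable.sum Finset.univ fun j _ => hij i j
  have hexp : ∀ r, (sqMat d σ r (θ r t y)).mulVec ξ ⬝ᵥ ξ =
      ∑ i, ∑ j, sqMat d σ r (θ r t y) i j * ξ j * ξ i := fun r => by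
    simp [mulVec, dotProduct, Finset.sum_mul]
  have heq : (freezeCov d σ θ t y s t).mulVec ξ ⬝ᵥ ξ =
      ∫ r in s..t, (sqMat d σ r (θ r t y)).mulVec ξ ⬝ᵥ ξ := by
    simp_rw [hexp]
    rw [intervalIntegral.integral_finsetSum fun i _ => hsum i]
    simp_rw [intervalIntegral.integral_finsetSum fun j _ => hij _ j,
      intervalIntegral.integral_mul_const]
    simp [freezeCov, mulVec, dotProduct, Finset.sum_mul]
  have h_int : IntervalIntegrable (fun r => (sqMat d σ r (θ r t y)).mulVec ξ ⬝ᵥ ξ)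
      volume s t := by
    simp_rw [hexp]
    simpa only [Finset.sum_fn] using IntervalIntegrable.sum Finset.univ fun i _ => hsum i
  rw [heq]
  constructor
  · calc (t - s) / κ₀ * (ξ ⬝ᵥ ξ) = ∫ _r in s..t, κ₀⁻¹ * (ξ ⬝ᵥ ξ) := by
          rw [intervalIntegral.integral_const, smul_eq_mul]; ring
      _ ≤ _ := intervalIntegral.integral_mono_on hst intervalIntegrable_const h_int
          fun r hr => (hσ.2.1 r (hs.trans hr.1) _ ξ).1
  · calc _ ≤ ∫ _r in s..t, κ₀ * (ξ ⬝ᵥ ξ) :=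
          intervalIntegral.integral_mono_on hst h_int intervalIntegrable_const
          fun r hr => (hσ.2.1 r (hs.trans hr.1) _ ξ).2
      _ = κ₀ * (t - s) * (ξ ⬝ᵥ ξ) := by
          rw [intervalIntegral.integral_const, smul_eq_mul]; ring

lemma frozenDensity_eq (hθ : IsFlow d b θ) {s t : ℝ} (hs : 0 ≤ s) (ht : 0 ≤ t) (x y : Vec d) :
    frozenDensity d b σ θ t y s x t y =
      (Real.sqrt ((2 * Real.pi) ^ d * (freezeCov d σ θ t y s t).det))⁻¹ *
        Real.exp (-(1 / 2) * inner ℝ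
          (toEuclideanCLM (𝕜 := ℝ) (freezeCov d σ θ t y s t)⁻¹ (x - θ s t y))
          (x - θ s t y)) := by
  have h : freezeMean d b θ t y s t + x - y = x - θ s t y := by
    rw [hθ t s ht hs y, freezeMean, intervalIntegral.integral_symm]
    abel
  rw [frozenDensity, h, real_inner_comm, inner_toEuclideanCLM, dotProduct_comm]

end Frozen

section GaussianKernel

variable {d : ℕ}

lemma gaussk_mono {l l' t : ℝ} (hl : l' ≤ l) (ht : 0 < t) (x : Vec d) :
    gaussk d l t x ≤ gaussk d l' t x := by
  unfold gaussk
  gcongr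

lemma gaussk_nonneg {l t : ℝ} (ht : 0 < t) (x : Vec d) : 0 ≤ gaussk d l t x := by
  unfold gaussk; positivity

/-- The Gaussian kernel tolerates a linear change of its argument and a shift of order `t`. -/
lemma gaussk_le_of_norm_le {l t T κ M : ℝ} (hl : 0 < l) (ht : 0 < t) (htT : t < T)
    (hM : 0 < M) {u v : Vec d} (h : ‖u‖ ≤ (‖v‖ + κ * t) * M) :
    gaussk d l t v ≤ Real.exp (l * κ ^ 2 * T) * gaussk d (l / (2 * M ^ 2)) t u := by
  have h1 : ‖u‖ ^ 2 ≤ 2 * M ^ 2 * (‖v‖ ^ 2 + κ ^ 2 * t ^ 2) := by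
    calc ‖u‖ ^ 2 ≤ ((‖v‖ + κ * t) * M) ^ 2 := by gcongr
      _ ≤ _ := by nlinarith [mul_nonneg (sq_nonneg M) (sq_nonneg (‖v‖ - κ * t))]
  have h2 : -l * ‖v‖ ^ 2 / t ≤ l * κ ^ 2 * T + -(l / (2 * M ^ 2)) * ‖u‖ ^ 2 / t := by
    have h3 : l / (2 * M ^ 2) * ‖u‖ ^ 2 ≤ l * (‖v‖ ^ 2 + κ ^ 2 * t ^ 2) := by
      rw [div_mul_eq_mul_div, div_le_iff₀ (by positivity)]
      nlinarith
    have h4 : l / (2 * M ^ 2) * ‖u‖ ^ 2 / t ≤ l * ‖v‖ ^ 2 / t + l * κ ^ 2 * t := by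
      rw [div_add' _ _ _ ht.ne']
      gcongr
      linarith
    have h5 : l * κ ^ 2 * t ≤ l * κ ^ 2 * T := by gcongr
    rw [neg_mul, neg_mul, neg_div, neg_div]
    linarith
  unfold gaussk
  calc t ^ (-(d : ℝ) / 2) * Real.exp (-l * ‖v‖ ^ 2 / t)
      ≤ t ^ (-(d : ℝ) / 2) *
        Real.exp (l * κ ^ 2 * T + -(l / (2 * M ^ 2)) * ‖u‖ ^ 2 / t) := by gcongr
    _ = _ := by rw [Real.exp_add]; ring

/-- Gaussian kernels with the same parameter form a convolution semigroup up to a constant. -/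
lemma gaussk_convolution {l u v : ℝ} (hl : 0 < l) (hu : 0 < u) (hv : 0 < v) (p q : Vec d) :
    Integrable (fun z => gaussk d l u (p - z) * gaussk d l v (z - q)) ∧
      ∫ z, gaussk d l u (p - z) * gaussk d l v (z - q) =
        (Real.pi / l) ^ ((d : ℝ) / 2) * gaussk d l (u + v) (p - q) := by
  set β : ℝ := l * (u + v) / (u * v) with hβ
  have hβ0 : 0 < β := by positivity
  set m : Vec d := (u + v)⁻¹ • (v • p + u • q) with hm
  have h_int := GaussianFourier.integral_rexp_neg_mul_sq_norm (V := Vec d) hβ0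
  rw [finrank_euclideanSpace_fin] at h_int
  have hi0 : Integrable (fun z : Vec d => Real.exp (-β * ‖z‖ ^ 2)) :=
    not_imp_comm.1 integral_undef (by rw [h_int]; positivity)
  have hi : Integrable (fun z : Vec d => Real.exp (-β * ‖z - m‖ ^ 2)) := hi0.comp_sub_right m
  have hsq : ∀ z, -l * ‖p - z‖ ^ 2 / u + -l * ‖z - q‖ ^ 2 / v =
      -l * ‖p - q‖ ^ 2 / (u + v) + -β * ‖z - m‖ ^ 2 := fun z => by
    have hpq : p - q = (p - z) + (z - q) := by abel
    have hzm : z - m = (u + v)⁻¹ • (u • (z - q) - v • (p - z)) := by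
      have : z = (u + v)⁻¹ • ((u + v) • z) := by
        rw [smul_smul, inv_mul_cancel₀ (by positivity), one_smul]
      nth_rewrite 1 [this]
      rw [hm, ← smul_sub]
      congr 1
      module
    rw [hpq, hzm, norm_smul, mul_pow, norm_sub_sq_real (u • (z - q)) (v • (p - z)), norm_add_sq_real, norm_smul, norm_smul,
      inner_smul_left, inner_smul_right, real_inner_comm (p - z) (z - q), Real.norm_eq_abs,
      Real.norm_eq_abs, Real.norm_eq_abs, abs_of_pos hu, abs_of_pos hv,
      abs_of_pos (inv_pos.2 (add_pos hu hv)), hβ, conj_trivial]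
    have : u + v ≠ 0 := by positivity
    field_simp
    ring
  have hprod : ∀ z, gaussk d l u (p - z) * gaussk d l v (z - q) =
      (u ^ (-(d : ℝ) / 2) * v ^ (-(d : ℝ) / 2) * Real.exp (-l * ‖p - q‖ ^ 2 / (u + v))) *
        Real.exp (-β * ‖z - m‖ ^ 2) := fun z => by
    unfold gaussk
    rw [mul_assoc _ (Real.exp _) (Real.exp _), ← Real.exp_add, ← hsq, Real.exp_add]
    ring
  simp_rw [hprod]
  refine ⟨hi.const_mul _, ?_⟩
  rw [integral_const_mul, integral_sub_right_eq_self (fun z : Vec d => Real.exp (-β * ‖z‖ ^ 2)) m,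
    h_int, gaussk]
  have hβ' : Real.pi / β = Real.pi / l * (u * v * (u + v)⁻¹) := by
    rw [hβ]; field_simp
  rw [hβ', Real.mul_rpow (by positivity) (by positivity),
    Real.mul_rpow (by positivity) (by positivity), Real.mul_rpow hu.le hv.le,
    Real.inv_rpow (by positivity), neg_div, Real.rpow_neg hu.le, Real.rpow_neg hv.le,
    Real.rpow_neg (by positivity)]
  have h1 : u ^ ((d : ℝ) / 2) ≠ 0 := by positivity
  have h2 : v ^ ((d : ℝ) / 2) ≠ 0 := by positivity
  field_simp

end GaussianKernel

/-- A majorant of the Beta integrand which is a sum of pure powers. -/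
lemma rpow_mul_rpow_le {p q x y : ℝ} (hp : 0 ≤ p) (hq : 0 ≤ q) (hx : 0 < x) (hy : 0 < y) :
    x ^ (p - 1) * y ^ (q - 1) ≤
      (x + y)⁻¹ * ((x + y) ^ p * y ^ (q - 1) + (x + y) ^ q * x ^ (p - 1)) := by
  rw [inv_mul_eq_div, le_div_iff₀ (by positivity)]
  have h1 : x ^ p ≤ (x + y) ^ p := Real.rpow_le_rpow hx.le (by linarith) hp
  have h2 : y ^ q ≤ (x + y) ^ q := Real.rpow_le_rpow hy.le (by linarith) hq
  have e1 : x ^ (p - 1) * x = x ^ p := by rw [← Real.rpow_add_one hx.ne']; simp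
  have e2 : y ^ (q - 1) * y = y ^ q := by rw [← Real.rpow_add_one hy.ne']; simp
  calc x ^ (p - 1) * y ^ (q - 1) * (x + y)
      = (x ^ (p - 1) * x) * y ^ (q - 1) + (y ^ (q - 1) * y) * x ^ (p - 1) := by ring
    _ ≤ _ := by rw [e1, e2]; gcongr

/-- Bound for a time integral with integrable singularities at both end points. -/
lemma abs_integral_le_of_beta {F : ℝ → ℝ} {p q s t D : ℝ} (hp : 0 < p) (hq : 0 < q)
    (hst : s < t) (hD : 0 ≤ D)
    (hF : ∀ r, s < r → r < t → |F r| ≤ D * ((r - s) ^ (p - 1) * (t - r) ^ (q - 1))) :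
    |∫ r in s..t, F r| ≤ D * (p⁻¹ + q⁻¹) * (t - s) ^ (p + q - 1) := by
  have hL : 0 < t - s := sub_pos.2 hst
  have hi1 : IntervalIntegrable (fun r => (t - r) ^ (q - 1)) volume s t := by
    have := (intervalIntegral.intervalIntegrable_rpow' (a := t - s) (b := t - t)
      (r := q - 1) (by linarith)).comp_sub_left t
    simpa using this
  have hi2 : IntervalIntegrable (fun r => (r - s) ^ (p - 1)) volume s t := by
    have := (intervalIntegral.intervalIntegrable_rpow' (a := s - s) (b := t - s)
      (r := p - 1) (by linarith)).comp_sub_right s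
    simpa using this
  have e1 : ∫ r in s..t, (t - r) ^ (q - 1) = (t - s) ^ q / q := by
    rw [intervalIntegral.integral_comp_sub_left (fun r => r ^ (q - 1)),
      integral_rpow (Or.inl (by linarith))]
    simp [Real.zero_rpow hq.ne']
  have e2 : ∫ r in s..t, (r - s) ^ (p - 1) = (t - s) ^ p / p := by
    rw [intervalIntegral.integral_comp_sub_right (fun r => r ^ (p - 1)),
      integral_rpow (Or.inl (by linarith))]
    simp [Real.zero_rpow hp.ne']
  have hle := intervalIntegral.norm_integral_le_of_norm_le (μ := volume) (f := F)
    (g := fun r => D * ((t - s)⁻¹ * ((t - s) ^ p * (t - r) ^ (q - 1) +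
      (t - s) ^ q * (r - s) ^ (p - 1)))) hst.le (by
      filter_upwards [Measure.ae_ne volume t] with r hrt hr
      have hr' : r < t := lt_of_le_of_ne hr.2 hrt
      refine (hF r hr.1 hr').trans (mul_le_mul_of_nonneg_left ?_ hD)
      have := rpow_mul_rpow_le hp.le hq.le (sub_pos.2 hr.1) (sub_pos.2 hr')
      rwa [show r - s + (t - r) = t - s by ring] at this)
    ((((hi1.const_mul _).add (hi2.const_mul _)).const_mul _).const_mul _)
  refine hle.trans_eq ?_
  rw [intervalIntegral.integral_const_mul, intervalIntegral.integral_const_mul,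
    intervalIntegral.integral_add (hi1.const_mul _) (hi2.const_mul _),
    intervalIntegral.integral_const_mul, intervalIntegral.integral_const_mul, e1, e2,
    Real.rpow_sub_one hL.ne', Real.rpow_add hL]
  field_simp
  ring

section ParametrixKernel

variable {d : ℕ} {σ : ℝ → Vec d → Matrix (Fin d) (Fin d) ℝ} {b : ℝ → Vec d → Vec d}
  {θ : ℝ → ℝ → Vec d → Vec d} {κ₀ α κ₁ : ℝ}

/-- Upper bound for the normalised frozen Gaussian. -/
lemma frozenDensity_le (hκ₀ : 1 ≤ κ₀) (hκ₁ : 0 ≤ κ₁) (hσ : EllipticHolder d σ κ₀ α)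
    (hb : HolderDrift d b κ₁ 0) (hθ : IsFlow d b θ) {s t : ℝ} (hs : 0 ≤ s) (hst : s < t)
    (x y : Vec d) :
    frozenDensity d b σ θ t y s x t y ≤
      κ₀ ^ ((d : ℝ) / 2) * gaussk d (1 / (2 * κ₀)) (t - s) (x - θ s t y) := by
  have hτ : 0 < t - s := sub_pos.2 hst
  have hκ0 : 0 < κ₀ := by linarith
  have hcov := freezeCov_bounds hκ₀ hκ₁ hσ hb hθ hs hst.le y
  have hsym : (freezeCov d σ θ t y s t).IsSymm := freezeCov_isSymm t y s t
  obtain ⟨-, -, h3⟩ := elliptic_inv_bounds hsym (lo := (t - s) / κ₀) (hi := κ₀ * (t - s))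
    (by positivity) (by positivity) hcov
  have hdet := pow_le_det_of_elliptic hsym (lo := (t - s) / κ₀) (by positivity)
    fun ξ => (hcov ξ).1
  rw [frozenDensity_eq hθ hs (hs.trans hst.le), gaussk, ← mul_assoc]
  refine mul_le_mul ?_ (Real.exp_le_exp.2 ?_) (Real.exp_nonneg _) (by positivity)
  · have h1 : ((t - s) / κ₀) ^ d ≤ (2 * Real.pi) ^ d * (freezeCov d σ θ t y s t).det := by
      have : (1 : ℝ) ≤ (2 * Real.pi) ^ d := one_le_pow₀ (by linarith [Real.pi_gt_three])
      have h0 : (0 : ℝ) < ((t - s) / κ₀) ^ d := by positivity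
      nlinarith
    have h2 : κ₀ ^ ((d : ℝ) / 2) * (t - s) ^ (-(d : ℝ) / 2) =
        (Real.sqrt (((t - s) / κ₀) ^ d))⁻¹ := by
      rw [Real.sqrt_eq_rpow, ← Real.rpow_natCast, ← Real.rpow_mul (by positivity),
        Real.div_rpow hτ.le hκ0.le, neg_div, Real.rpow_neg hτ.le, inv_div,
        show (d : ℝ) * (1 / 2) = (d : ℝ) / 2 by ring, ← div_eq_mul_inv]
    rw [h2]
    gcongr
  · have h4 := h3 (x - θ s t y)
    rw [← div_le_iff₀' (by positivity)] at h4
    have h5 : -(1 / (2 * κ₀)) * ‖x - θ s t y‖ ^ 2 / (t - s) =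
        -(1 / 2) * (‖x - θ s t y‖ ^ 2 / (κ₀ * (t - s))) := by field_simp
    rw [h5]
    linarith

lemma frozenDensity_nonneg (τ : ℝ) (ξ : Vec d) (s : ℝ) (x : Vec d) (t : ℝ) (y : Vec d) :
    0 ≤ frozenDensity d b σ θ τ ξ s x t y := by
  unfold frozenDensity; positivity

/-- Bounds for the first two derivatives of the frozen Gaussian. -/
lemma frozenDensity_deriv_le (hκ₀ : 1 ≤ κ₀) (hκ₁ : 0 ≤ κ₁) (hσ : EllipticHolder d σ κ₀ α)
    (hb : HolderDrift d b κ₁ 0) (hθ : IsFlow d b θ) {s t : ℝ} (hs : 0 ≤ s) (hst : s < t)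
    (x y : Vec d) (i j : Fin d) :
    |gradEntry d (fun x' => frozenDensity d b σ θ t y s x' t y) x i| ≤
        κ₀ / (t - s) * ‖x - θ s t y‖ * frozenDensity d b σ θ t y s x t y ∧
    |hessEntry d (fun x' => frozenDensity d b σ θ t y s x' t y) x i j| ≤
        ((κ₀ / (t - s) * ‖x - θ s t y‖) ^ 2 + κ₀ / (t - s)) *
          frozenDensity d b σ θ t y s x t y := by
  have hτ : 0 < t - s := sub_pos.2 hst
  have hκ0 : 0 < κ₀ := by linarith
  have hcov := freezeCov_bounds hκ₀ hκ₁ hσ hb hθ hs hst.le y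
  have hsym : (freezeCov d σ θ t y s t).IsSymm := freezeCov_isSymm t y s t
  obtain ⟨h1, h2, -⟩ := elliptic_inv_bounds hsym (lo := (t - s) / κ₀) (hi := κ₀ * (t - s))
    (by positivity) (by positivity) hcov
  rw [inv_div] at h2
  have hnn := frozenDensity_nonneg (b := b) (σ := σ) (θ := θ) t y s x t y
  have hfun := fun x' => frozenDensity_eq (σ := σ) hθ hs (hs.trans hst.le) x' y
  set L : Vec d →L[ℝ] Vec d := toEuclideanCLM (𝕜 := ℝ) (freezeCov d σ θ t y s t)⁻¹
  set G := frozenDensity d b σ θ t y s x t y with hG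
  have hone : ∀ k : Fin d, ‖EuclideanSpace.single k (1 : ℝ)‖ = 1 := fun k => by simp
  have hin : ∀ (u : Vec d) (k : Fin d),
      |inner ℝ (L u) (EuclideanSpace.single k (1 : ℝ))| ≤ κ₀ / (t - s) * ‖u‖ := fun u k => by
    refine (abs_real_inner_le_norm _ _).trans ?_
    rw [hone, mul_one]
    exact h2 u
  constructor
  · rw [gradEntry, funext hfun, fderiv_gaussian_apply L h1, ← hfun, ← hG, neg_mul, abs_neg,
      abs_mul, abs_of_nonneg hnn, mul_comm]
    exact mul_le_mul_of_nonneg_right (hin _ i) hnn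
  · rw [hessEntry, funext hfun, iteratedFDeriv_two_gaussian_apply L h1, ← hfun, ← hG,
      abs_mul, abs_of_nonneg hnn, mul_comm]
    refine mul_le_mul_of_nonneg_right ((abs_sub _ _).trans ?_) hnn
    have h4 := hin (EuclideanSpace.single i (1 : ℝ)) j
    rw [hone, mul_one] at h4
    refine add_le_add ?_ h4
    rw [abs_mul, sq]
    exact mul_le_mul (hin _ i) (hin _ j) (abs_nonneg _) (by positivity)

/-- Gaussian bound for the parametrix kernel, in terms of the backward flow. -/
lemma abs_paramKernel_le {T : ℝ} (hα : α ∈ Ioo (0 : ℝ) 1) (hκ₀ : 1 ≤ κ₀) (hκ₁ : 0 ≤ κ₁)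
    (hσ : EllipticHolder d σ κ₀ α) (hb : HolderDrift d b κ₁ 0) (hθ : IsFlow d b θ)
    {s t : ℝ} (hs : 0 ≤ s) (hst : s < t) (htT : t - s < T) (x y : Vec d) :
    |paramKernel d b σ θ s x t y| ≤
      (d ^ 3 * κ₀ ^ 4 + d * κ₁ * κ₀ * (1 + √T) * T ^ ((1 - α) / 2)) *
        κ₀ ^ ((d : ℝ) / 2) * Real.exp (9 * κ₀) *
        (t - s) ^ (-1 + α / 2) * gaussk d (1 / (4 * κ₀)) (t - s) (x - θ s t y) := by
  have hτ : 0 < t - s := sub_pos.2 hst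
  have hT : 0 < T := hτ.trans htT
  have hκ0 : 0 < κ₀ := by linarith
  have hD := fun i j => frozenDensity_deriv_le hκ₀ hκ₁ hσ hb hθ hs hst x y i j
  have hnn := frozenDensity_nonneg (b := b) (σ := σ) (θ := θ) t y s x t y
  have hle := frozenDensity_le hκ₀ hκ₁ hσ hb hθ hs hst x y
  set G := frozenDensity d b σ θ t y s x t y with hG
  set τ := t - s with hτdef
  set w := x - θ s t y with hw
  set ζ := ‖w‖ / √τ with hζ
  have hsτ : 0 < √τ := Real.sqrt_pos.2 hτ
  have hζ0 : 0 ≤ ζ := by positivity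
  have hwζ : ‖w‖ = ζ * √τ := by rw [hζ]; field_simp
  have hsq : √τ ^ 2 = τ := Real.sq_sqrt hτ.le
  have hpow : ‖w‖ ^ α ≤ (1 + ζ) * τ ^ (α / 2) := by
    rw [hwζ, Real.mul_rpow hζ0 hsτ.le, Real.sqrt_eq_rpow, ← Real.rpow_mul hτ.le,
      show 1 / 2 * α = α / 2 by ring]
    refine mul_le_mul_of_nonneg_right ?_ (by positivity)
    calc ζ ^ α ≤ (1 + ζ) ^ α := Real.rpow_le_rpow hζ0 (by linarith) hα.1.le
      _ ≤ (1 + ζ) ^ (1 : ℝ) := Real.rpow_le_rpow_of_exponent_le (by linarith) hα.2.le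
      _ = 1 + ζ := Real.rpow_one _
  have hτα : τ ^ (α / 2) / τ = τ ^ (-1 + α / 2) := by
    rw [neg_add_eq_sub, Real.rpow_sub_one hτ.ne']
  have hsα : (√τ)⁻¹ ≤ T ^ ((1 - α) / 2) * τ ^ (-1 + α / 2) := by
    have e : (√τ)⁻¹ = τ ^ ((1 - α) / 2) * τ ^ (-1 + α / 2) := by
      rw [← Real.rpow_add hτ, Real.sqrt_eq_rpow, ← Real.rpow_neg hτ.le]
      congr 1; ring
    rw [e]
    refine mul_le_mul_of_nonneg_right ?_ (by positivity)
    exact Real.rpow_le_rpow hτ.le htT.le (by linarith [hα.2])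
  have hhess : ∀ i j, |((1 / 2) * sqMat d σ s x i j - (1 / 2) * sqMat d σ s (θ s t y) i j) *
      hessEntry d (fun x' => frozenDensity d b σ θ t y s x' t y) x i j| ≤
      d * κ₀ ^ 4 * τ ^ (-1 + α / 2) * ((1 + ζ) ^ 3 * G) := fun i j => by
    rw [← mul_sub, abs_mul, abs_mul, abs_of_pos (by norm_num : (0 : ℝ) < 1 / 2)]
    have h1 := hσ.abs_sqMat_sub_le hκ₀ hs x (θ s t y) i j
    rw [← hw] at h1
    have h2 : (κ₀ / τ * ‖w‖) ^ 2 + κ₀ / τ ≤ κ₀ ^ 2 / τ * (1 + ζ) ^ 2 := by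
      have e : (κ₀ / τ * ‖w‖) ^ 2 = κ₀ ^ 2 / τ * ζ ^ 2 := by
        rw [hwζ, mul_pow, mul_pow, hsq]; field_simp
      have e2 : κ₀ / τ ≤ κ₀ ^ 2 / τ := by gcongr; nlinarith
      have e3 : 0 ≤ κ₀ ^ 2 / τ * ζ := by positivity
      rw [e]
      nlinarith
    calc 1 / 2 * |sqMat d σ s x i j - sqMat d σ s (θ s t y) i j| *
          |hessEntry d (fun x' => frozenDensity d b σ θ t y s x' t y) x i j|
        ≤ 1 / 2 * (d * (2 * κ₀ ^ 2 * ((1 + ζ) * τ ^ (α / 2)))) *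
          (κ₀ ^ 2 / τ * (1 + ζ) ^ 2 * G) := by
          refine mul_le_mul ?_ ((hD i j).2.trans ?_) (abs_nonneg _) (by positivity)
          · refine mul_le_mul_of_nonneg_left (h1.trans ?_) (by norm_num)
            gcongr
          · exact mul_le_mul_of_nonneg_right h2 hnn
      _ = d * κ₀ ^ 4 * (τ ^ (α / 2) / τ) * ((1 + ζ) ^ 3 * G) := by ring
      _ = _ := by rw [hτα]
  have hgrad : ∀ i, |(b s x i - b s (θ s t y) i) *
      gradEntry d (fun x' => frozenDensity d b σ θ t y s x' t y) x i| ≤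
      κ₁ * κ₀ * (1 + √T) * T ^ ((1 - α) / 2) * τ ^ (-1 + α / 2) * ((1 + ζ) ^ 3 * G) :=
    fun i => by
    have h1 : |b s x i - b s (θ s t y) i| ≤ κ₁ + κ₁ * ‖w‖ := by
      refine le_trans ?_ (hb.norm_sub_le hκ₁ hs x (θ s t y))
      exact PiLp.norm_apply_le (b s x - b s (θ s t y)) i
    have hτT : √τ ≤ √T := Real.sqrt_le_sqrt htT.le
    have h2 : (1 + ‖w‖) * ζ ≤ (1 + √T) * (1 + ζ) ^ 3 := by
      have a1 : 1 + ‖w‖ ≤ (1 + √T) * (1 + ζ) := by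
        rw [hwζ]
        nlinarith [mul_le_mul_of_nonneg_left hτT hζ0, Real.sqrt_nonneg T]
      have a2 : ζ ≤ (1 + ζ) ^ 2 := by nlinarith
      calc (1 + ‖w‖) * ζ ≤ ((1 + √T) * (1 + ζ)) * (1 + ζ) ^ 2 := by gcongr
        _ = _ := by ring
    rw [abs_mul]
    calc |b s x i - b s (θ s t y) i| *
          |gradEntry d (fun x' => frozenDensity d b σ θ t y s x' t y) x i|
        ≤ (κ₁ + κ₁ * ‖w‖) * (κ₀ / τ * ‖w‖ * G) :=
          mul_le_mul h1 (hD i i).1 (abs_nonneg _) (by positivity)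
      _ = κ₁ * κ₀ * ((1 + ‖w‖) * ζ) * (√τ)⁻¹ * G := by
          have : ‖w‖ / τ = ζ * (√τ)⁻¹ := by
            rw [hζ]
            nth_rewrite 1 [← hsq]
            field_simp
          calc _ = κ₁ * κ₀ * (1 + ‖w‖) * (‖w‖ / τ) * G := by ring
            _ = _ := by rw [this]; ring
      _ ≤ κ₁ * κ₀ * ((1 + √T) * (1 + ζ) ^ 3) * (T ^ ((1 - α) / 2) * τ ^ (-1 + α / 2)) * G := by
          gcongr
      _ = _ := by ring
  have hexp : (1 + ζ) ^ 3 * G ≤ κ₀ ^ ((d : ℝ) / 2) * Real.exp (9 * κ₀) *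
      gaussk d (1 / (4 * κ₀)) τ w := by
    have h1 : (1 + ζ) ^ 3 ≤ Real.exp (9 * κ₀ + ζ ^ 2 / (4 * κ₀)) := by
      calc (1 + ζ) ^ 3 ≤ Real.exp ζ ^ 3 := by
            have := Real.add_one_le_exp ζ
            gcongr
            linarith
        _ = Real.exp (3 * ζ) := by rw [← Real.exp_nat_mul]; norm_num
        _ ≤ _ := by
          refine Real.exp_le_exp.2 ?_
          rw [← sub_le_iff_le_add', le_div_iff₀ (by positivity)]
          nlinarith [sq_nonneg (ζ - 6 * κ₀)]
    have h2 : ζ ^ 2 = ‖w‖ ^ 2 / τ := by rw [hζ, div_pow, hsq]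
    calc (1 + ζ) ^ 3 * G ≤ Real.exp (9 * κ₀ + ζ ^ 2 / (4 * κ₀)) *
          (κ₀ ^ ((d : ℝ) / 2) * gaussk d (1 / (2 * κ₀)) τ w) :=
          mul_le_mul h1 hle hnn (Real.exp_nonneg _)
      _ = κ₀ ^ ((d : ℝ) / 2) * Real.exp (9 * κ₀) * (τ ^ (-(d : ℝ) / 2) *
          (Real.exp (ζ ^ 2 / (4 * κ₀)) * Real.exp (-(1 / (2 * κ₀)) * ‖w‖ ^ 2 / τ))) := by
          rw [Real.exp_add, gaussk]; ring
      _ = _ := by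
          rw [← Real.exp_add, gaussk, h2]
          congr 3
          field_simp
          ring
  rw [paramKernel]
  calc _ ≤ (∑ _i : Fin d, ∑ _j : Fin d, d * κ₀ ^ 4 * τ ^ (-1 + α / 2) * ((1 + ζ) ^ 3 * G)) +
        ∑ _i : Fin d, κ₁ * κ₀ * (1 + √T) * T ^ ((1 - α) / 2) * τ ^ (-1 + α / 2) *
          ((1 + ζ) ^ 3 * G) := by
        refine (abs_add_le _ _).trans (add_le_add ?_ ?_)
        · refine (Finset.abs_sum_le_sum_abs _ _).trans (Finset.sum_le_sum fun i _ => ?_)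
          exact (Finset.abs_sum_le_sum_abs _ _).trans (Finset.sum_le_sum fun j _ => hhess i j)
        · exact (Finset.abs_sum_le_sum_abs _ _).trans (Finset.sum_le_sum fun i _ => hgrad i)
    _ = (d ^ 3 * κ₀ ^ 4 + d * κ₁ * κ₀ * (1 + √T) * T ^ ((1 - α) / 2)) * τ ^ (-1 + α / 2) *
          ((1 + ζ) ^ 3 * G) := by
        simp only [Finset.sum_const, Finset.card_univ, Fintype.card_fin, nsmul_eq_mul]
        ring
    _ ≤ (d ^ 3 * κ₀ ^ 4 + d * κ₁ * κ₀ * (1 + √T) * T ^ ((1 - α) / 2)) * τ ^ (-1 + α / 2) *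
          (κ₀ ^ ((d : ℝ) / 2) * Real.exp (9 * κ₀) * gaussk d (1 / (4 * κ₀)) τ w) := by
        gcongr
    _ = _ := by ring

end ParametrixKernel

section Iteration

variable {d : ℕ} {b : ℝ → Vec d → Vec d} {θ θ1 : ℝ → ℝ → Vec d → Vec d} {ρ : Vec d → ℝ}
  {T κ₁ : ℝ}

/-- Comparison of Gaussian kernels along the mollified forward flow and the backward flow. -/
lemma gaussk_flow_le (hρ : IsMollifier d ρ) (hκ₁ : 0 ≤ κ₁) (hb : HolderDrift d b κ₁ 0)
    (hθ : IsFlow d b θ) (hθ1 : IsFlow d (mollifiedDrift d ρ 1 b) θ1) {l s t : ℝ} (hl : 0 < l)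
    (hs : 0 ≤ s) (hst : s < t) (htT : t - s < T) (x y : Vec d) {p q : ℝ}
    (hp : p ∈ Icc s t) (hq : q ∈ Icc s t) :
    gaussk d l (t - s) (θ1 p s x - θ p t y) ≤
      Real.exp (l * (2 * κ₁) ^ 2 * T) *
        gaussk d (l / (2 * Real.exp (κ₁ * T) ^ 2)) (t - s) (θ1 q s x - θ q t y) := by
  have hτ : 0 < t - s := sub_pos.2 hst
  have hqp : |q - p| ≤ t - s :=
    abs_sub_le_iff.2 ⟨by linarith [hp.1, hq.2], by linarith [hp.2, hq.1]⟩
  refine gaussk_le_of_norm_le hl hτ htT (Real.exp_pos _) ?_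
  refine (norm_mollifiedFlow_sub_flow_le hρ hκ₁ hb hθ hθ1 hs (hs.trans hst.le) x y
    (hs.trans hp.1) (hs.trans hq.1)).trans ?_
  gcongr
  exact hqp.trans htT.le

/-- The spatial integral in the convolution of two kernels with Gaussian bounds. -/
lemma abs_integral_mul_le_of_gaussk {F G : Vec d → ℝ} {A B l u v : ℝ} {p q : Vec d}
    (hl : 0 < l) (hu : 0 < u) (hv : 0 < v) (hA : 0 ≤ A)
    (hF : ∀ z, |F z| ≤ A * gaussk d l u (p - z)) (hG : ∀ z, |G z| ≤ B * gaussk d l v (z - q)) :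
    |∫ z, F z * G z| ≤
      A * B * ((Real.pi / l) ^ ((d : ℝ) / 2) * gaussk d l (u + v) (p - q)) := by
  obtain ⟨hi, he⟩ := gaussk_convolution hl hu hv p q
  rw [← he, ← integral_const_mul, ← Real.norm_eq_abs]
  refine norm_integral_le_of_norm_le (hi.const_mul _) (Filter.Eventually.of_forall fun z => ?_)
  rw [norm_mul]
  calc ‖F z‖ * ‖G z‖ ≤ (A * gaussk d l u (p - z)) * (B * gaussk d l v (z - q)) :=
        mul_le_mul (hF z) (hG z) (norm_nonneg _) (mul_nonneg hA (gaussk_nonneg hu _))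
    _ = _ := by ring

/-- Gaussian bound for a space-time convolution, in terms of the backward flow. -/
lemma abs_spaceTimeConv_le (hρ : IsMollifier d ρ) (hκ₁ : 0 ≤ κ₁) (hb : HolderDrift d b κ₁ 0)
    (hθ : IsFlow d b θ) (hθ1 : IsFlow d (mollifiedDrift d ρ 1 b) θ1)
    {f h : ℝ → Vec d → ℝ → Vec d → ℝ} {A B l p q : ℝ} (hA : 0 ≤ A) (hB : 0 ≤ B) (hl : 0 < l)
    (hp : 0 < p) (hq : 0 < q)
    (hf : ∀ s t : ℝ, 0 ≤ s → s < t → t - s < T → ∀ x y : Vec d,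
      |f s x t y| ≤ A * (t - s) ^ (p - 1) * gaussk d l (t - s) (θ1 t s x - y))
    (hh : ∀ s t : ℝ, 0 ≤ s → s < t → t - s < T → ∀ x y : Vec d,
      |h s x t y| ≤ B * (t - s) ^ (q - 1) * gaussk d l (t - s) (x - θ s t y))
    {s t : ℝ} (hs : 0 ≤ s) (hst : s < t) (htT : t - s < T) (x y : Vec d) :
    |spaceTimeConv d f h s x t y| ≤
      A * B * (Real.pi / l) ^ ((d : ℝ) / 2) * Real.exp (l * (2 * κ₁) ^ 2 * T) *
        (p⁻¹ + q⁻¹) * (t - s) ^ (p + q - 1) *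
        gaussk d (l / (2 * Real.exp (κ₁ * T) ^ 2)) (t - s) (x - θ s t y) := by
  have hτ : 0 < t - s := sub_pos.2 hst
  set g := gaussk d (l / (2 * Real.exp (κ₁ * T) ^ 2)) (t - s) (x - θ s t y) with hg
  have hg0 : 0 ≤ g := gaussk_nonneg hτ _
  refine (abs_integral_le_of_beta (D := A * B * (Real.pi / l) ^ ((d : ℝ) / 2) *
    Real.exp (l * (2 * κ₁) ^ 2 * T) * g) hp hq hst (by positivity) fun r hsr hrt => ?_).trans_eq
      (by ring)
  have hu : 0 < r - s := sub_pos.2 hsr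
  have hv : 0 < t - r := sub_pos.2 hrt
  have h1 := abs_integral_mul_le_of_gaussk (F := fun z => f s x r z) (G := fun z => h r z t y)
    (p := θ1 r s x) (q := θ r t y) (A := A * (r - s) ^ (p - 1)) (B := B * (t - r) ^ (q - 1))
    hl hu hv (by positivity) (fun z => hf s r hs hsr (by linarith) x z)
    (fun z => hh r t (hs.trans hsr.le) hrt (by linarith) z y)
  rw [show r - s + (t - r) = t - s by ring] at h1
  have h2 := gaussk_flow_le hρ hκ₁ hb hθ hθ1 hl hs hst htT x y (p := r) (q := s)
    ⟨hsr.le, hrt.le⟩ ⟨le_rfl, hst.le⟩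
  rw [hθ1.self hs, ← hg] at h2
  refine h1.trans ?_
  calc _ ≤ A * (r - s) ^ (p - 1) * (B * (t - r) ^ (q - 1)) *
        ((Real.pi / l) ^ ((d : ℝ) / 2) * (Real.exp (l * (2 * κ₁) ^ 2 * T) * g)) := by gcongr
    _ = _ := by ring

/-- Conversion of a Gaussian bound along the backward flow into one along the mollified
forward flow. -/
lemma forward_bound_of_backward_bound (hρ : IsMollifier d ρ) (hκ₁ : 0 ≤ κ₁)
    (hb : HolderDrift d b κ₁ 0) (hθ : IsFlow d b θ)
    (hθ1 : IsFlow d (mollifiedDrift d ρ 1 b) θ1) {C l e a s t : ℝ} (hC : 0 ≤ C) (hl : 0 < l)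
    (hs : 0 ≤ s) (hst : s < t) (htT : t - s < T) {x y : Vec d}
    (h : a ≤ C * (t - s) ^ e * gaussk d l (t - s) (x - θ s t y)) :
    a ≤ C * Real.exp (l * (2 * κ₁) ^ 2 * T) * (t - s) ^ e *
      gaussk d (l / (2 * Real.exp (κ₁ * T) ^ 2)) (t - s) (θ1 t s x - y) := by
  have hτ : 0 < t - s := sub_pos.2 hst
  have h2 := gaussk_flow_le hρ hκ₁ hb hθ hθ1 hl hs hst htT x y (p := s) (q := t)
    ⟨le_rfl, hst.le⟩ ⟨hst.le, le_rfl⟩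
  rw [hθ1.self hs, hθ.self (hs.trans hst.le)] at h2
  refine h.trans ?_
  calc _ ≤ C * (t - s) ^ e * (Real.exp (l * (2 * κ₁) ^ 2 * T) *
        gaussk d (l / (2 * Real.exp (κ₁ * T) ^ 2)) (t - s) (θ1 t s x - y)) := by gcongr
    _ = _ := by ring

/-- Gaussian bound for the iterated parametrix kernels, in terms of the backward flow. -/
lemma exists_backward_bound_iterKernel {α κ₀ : ℝ} (hT : 0 < T) (hα : α ∈ Ioo (0 : ℝ) 1)
    (hκ₀ : 1 ≤ κ₀) (hκ₁ : 0 < κ₁) (hρ : IsMollifier d ρ) (N : ℕ) :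
    ∃ C > (0 : ℝ), ∃ l > (0 : ℝ),
      ∀ (b : ℝ → Vec d → Vec d) (σ : ℝ → Vec d → Matrix (Fin d) (Fin d) ℝ)
        (θ θ1 : ℝ → ℝ → Vec d → Vec d),
        EllipticHolder d σ κ₀ α → HolderDrift d b κ₁ 0 →
        IsFlow d b θ → IsFlow d (mollifiedDrift d ρ 1 b) θ1 →
      ∀ s t : ℝ, 0 ≤ s → s < t → t - s < T → ∀ x y : Vec d,
        |iterKernel d (paramKernel d b σ θ) N s x t y| ≤
          C * (t - s) ^ ((N + 1 : ℝ) * α / 2 - 1) * gaussk d l (t - s) (x - θ s t y) := by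
  have hκ0 : 0 < κ₀ := by linarith
  set K : ℝ := (d ^ 3 * κ₀ ^ 4 + d * κ₁ * κ₀ * (1 + √T) * T ^ ((1 - α) / 2)) *
    κ₀ ^ ((d : ℝ) / 2) * Real.exp (9 * κ₀) with hK
  have hK0 : 0 ≤ K := by positivity
  have base : ∀ (b : ℝ → Vec d → Vec d) (σ : ℝ → Vec d → Matrix (Fin d) (Fin d) ℝ)
      (θ : ℝ → ℝ → Vec d → Vec d), EllipticHolder d σ κ₀ α → HolderDrift d b κ₁ 0 →
      IsFlow d b θ → ∀ s t : ℝ, 0 ≤ s → s < t → t - s < T → ∀ x y : Vec d,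
      |paramKernel d b σ θ s x t y| ≤ (K + 1) * (t - s) ^ (α / 2 - 1) *
        gaussk d (1 / (4 * κ₀)) (t - s) (x - θ s t y) := by
    intro b σ θ hσ hb hθ s t hs hst htT x y
    have hτ : 0 < t - s := sub_pos.2 hst
    refine (abs_paramKernel_le hα hκ₀ hκ₁.le hσ hb hθ hs hst htT x y).trans ?_
    rw [neg_add_eq_sub]
    have := gaussk_nonneg (l := 1 / (4 * κ₀)) hτ (x - θ s t y)
    gcongr
    linarith
  induction N with
  | zero =>
    refine ⟨K + 1, by positivity, 1 / (4 * κ₀), by positivity,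
      fun b σ θ θ1 hσ hb hθ _ s t hs hst htT x y => ?_⟩
    simpa [iterKernel] using base b σ θ hσ hb hθ s t hs hst htT x y
  | succ N ih =>
    obtain ⟨C, hC, l, hl, ih⟩ := ih
    set l₀ : ℝ := 1 / (4 * κ₀) / (2 * Real.exp (κ₁ * T) ^ 2) with hl₀
    set l' : ℝ := min l₀ l with hl'
    have hl'0 : 0 < l' := lt_min (by positivity) hl
    have hα2 : 0 < α / 2 := half_pos hα.1
    have hNα : 0 < (N + 1 : ℝ) * α / 2 := by have := hα.1; positivity
    refine ⟨(K + 1) * Real.exp (1 / (4 * κ₀) * (2 * κ₁) ^ 2 * T) * C *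
      (Real.pi / l') ^ ((d : ℝ) / 2) * Real.exp (l' * (2 * κ₁) ^ 2 * T) *
        ((α / 2)⁻¹ + ((N + 1 : ℝ) * α / 2)⁻¹), by positivity,
        l' / (2 * Real.exp (κ₁ * T) ^ 2), by positivity,
      fun b σ θ θ1 hσ hb hθ hθ1 s t hs hst htT x y => ?_⟩
    have key := abs_spaceTimeConv_le hρ hκ₁.le hb hθ hθ1 (T := T)
      (f := paramKernel d b σ θ) (h := iterKernel d (paramKernel d b σ θ) N)
      (A := (K + 1) * Real.exp (1 / (4 * κ₀) * (2 * κ₁) ^ 2 * T)) (B := C) (l := l')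
      (p := α / 2) (q := (N + 1 : ℝ) * α / 2) (by positivity) hC.le hl'0 hα2 hNα
      (fun s t hs hst htT x y => by
        have hτ : 0 < t - s := sub_pos.2 hst
        refine (forward_bound_of_backward_bound hρ hκ₁.le hb hθ hθ1 (by positivity)
          (by positivity) hs hst htT (base b σ θ hσ hb hθ s t hs hst htT x y)).trans ?_
        exact mul_le_mul_of_nonneg_left (gaussk_mono (min_le_left _ _) hτ _) (by positivity))
      (fun s t hs hst htT x y => by
        have hτ : 0 < t - s := sub_pos.2 hst
        refine (ih b σ θ θ1 hσ hb hθ hθ1 s t hs hst htT x y).trans ?_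
        exact mul_le_mul_of_nonneg_left (gaussk_mono (min_le_right _ _) hτ _) (by positivity))
      hs hst htT x y
    rw [show α / 2 + (N + 1 : ℝ) * α / 2 - 1 = ((N + 1 : ℕ) + 1 : ℝ) * α / 2 - 1 by
      push_cast; ring] at key
    exact key

end Iteration

/-- **Control of the iterated parametrix kernel.** Under (H^σ_α) with
`α ∈ (0,1)` and (H^b_0), with `b, σ` smooth in space with bounded derivatives of every
order, for any `T > 0` and `N ≥ 1` there are `C_N, λ_N > 0` depending only on
`Θ = (T,α,0,κ₀,κ₁,d)` such that
`|H^{⊗N}(s,x,t,y)| ≤ C_N (t−s)^{−1+Nα/2} 𝐠_{λ_N}(s,x,t,y)` on `𝔻^T_0`.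
(Here `iterKernel d H N = H^{⊗(N+1)}`.) -/
theorem iterated_parametrix_kernel_bound
    (d : ℕ) (T α κ₀ κ₁ : ℝ) (hT : 0 < T) (hα : α ∈ Set.Ioo (0 : ℝ) 1)
    (hκ₀ : 1 ≤ κ₀) (hκ₁ : 0 < κ₁)
    (ρ : Vec d → ℝ) (hρ : IsMollifier d ρ) (N : ℕ) :
    ∃ C > (0 : ℝ), ∃ l > (0 : ℝ),
      ∀ (b : ℝ → Vec d → Vec d) (σ : ℝ → Vec d → Matrix (Fin d) (Fin d) ℝ)
        (θ θ1 : ℝ → ℝ → Vec d → Vec d),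
        EllipticHolder d σ κ₀ α → HolderDrift d b κ₁ 0 →
        SmoothVecBounded d b → SmoothMatBounded d σ →
        IsFlow d b θ → IsFlow d (mollifiedDrift d ρ 1 b) θ1 →
      ∀ s t : ℝ, 0 ≤ s → s < t → t - s < T → ∀ x y : Vec d,
        |iterKernel d (paramKernel d b σ θ) N s x t y| ≤
          C * (t - s) ^ (-1 + (N + 1 : ℝ) * α / 2) * gaussk d l (t - s) (θ1 t s x - y) := by
  obtain ⟨C, hC, l, hl, h⟩ := exists_backward_bound_iterKernel hT hα hκ₀ hκ₁ hρ N
  refine ⟨C * Real.exp (l * (2 * κ₁) ^ 2 * T), by positivity,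
    l / (2 * Real.exp (κ₁ * T) ^ 2), by positivity,
    fun b σ θ θ1 hσ hb _ _ hθ hθ1 s t hs hst htT x y => ?_⟩
  rw [neg_add_eq_sub]
  exact forward_bound_of_backward_bound hρ hκ₁.le hb hθ hθ1 hC.le hl hs hst htT
    (h b σ θ θ1 hσ hb hθ hθ1 s t hs hst htT x y)
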